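/- arXiv:1205.6729 — 3 statements merged into one kernel-verified Lean document; each statement's English description precedes it below -/
import Mathlib

section
/- Let X be a locally compact, locally-P Tychonoff space not having P, where P is a closed hereditary Mrówka topological property, and suppose that either (1) X is paracompact and P is preserved under locally finite closed sums of subspaces, or (2) P is preserved under countable closed sums of subspaces. Then the partially ordered set (E_P(X), ≤) of one-point Tychonoff extensions of X having P contains an anti-order-isomorphic copy of the partially ordered set (E*(X), ≤) of one-point Tychonoff extensions of X that are first-countable at the added point; that is, there is an injective map F : E*(X) → E_P(X) such that for all Y₁, Y₂ ∈ E*(X), Y₁ ≤ Y₂ if and only if F(Y₂) ≤ F(Y₁). -/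
open Set Topology Filter

universe u

/-- A one-point Tychonoff extension of `X`: a Tychonoff space containing (a homeomorphic copy
of) `X` as a dense subspace whose complement is a single point `pt`. -/
structure OnePointExt (X : Type u) [TopologicalSpace X] : Type (u + 1) where
  carrier : Type u
  top : TopologicalSpace carrier
  t35 : @T35Space carrier top
  ι : X → carrier
  emb : @Topology.IsEmbedding X carrier _ top ι
  pt : carrier
  range_eq : Set.range ι = {pt}ᶜ
  dense : @DenseRange carrier top X ι

attribute [instance] OnePointExt.top OnePointExt.t35

variable {X : Type u} [TopologicalSpace X]

/-- The partial order on one-point extensions: `Y₁ ≤ Y₂` iff there is a continuous map from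
`Y₂` into `Y₁` fixing `X` pointwise. -/
def OnePointExt.le (Y1 Y2 : OnePointExt X) : Prop :=
  ∃ f : Y2.carrier → Y1.carrier, Continuous f ∧ ∀ x, f (Y2.ι x) = Y1.ι x

/-- Equivalence of extensions: a homeomorphism fixing `X` pointwise. -/
def OnePointExt.equiv (Y1 Y2 : OnePointExt X) : Prop :=
  ∃ h : Y1.carrier ≃ₜ Y2.carrier, ∀ x, h (Y1.ι x) = Y2.ι x

/-- `τ_Y : βX → βY`, the unique continuous extension of `id_X`. -/
noncomputable def OnePointExt.tau (Y : OnePointExt X) : StoneCech X → StoneCech Y.carrier :=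
  stoneCechExtend (continuous_stoneCechUnit.comp Y.emb.continuous)

/-- `Θ_X(Y) = τ_Y⁻¹(Y \ X)`, a subset of `βX`. -/
noncomputable def OnePointExt.theta (Y : OnePointExt X) : Set (StoneCech X) :=
  Y.tau ⁻¹' {stoneCechUnit Y.pt}

/-- A zero-set: `f⁻¹(0)` for a continuous `f : Z → [0,1]`. -/
def IsZeroSet {Z : Type u} [TopologicalSpace Z] (A : Set Z) : Prop :=
  ∃ f : Z → unitInterval, Continuous f ∧ A = f ⁻¹' {0}

/-- A cozero-set: a complement of a zero-set. -/
def IsCozeroSet {Z : Type u} [TopologicalSpace Z] (A : Set Z) : Prop :=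
  ∃ f : Z → unitInterval, Continuous f ∧ A = (f ⁻¹' {0})ᶜ

/-- `λ_P X = ⋃ { int_{βX} cl_{βX} C : C a cozero-set of X whose closure in X has P }`. -/
def lambdaP (P : (Z : Type u) → [TopologicalSpace Z] → Prop) (X : Type u)
    [TopologicalSpace X] : Set (StoneCech X) :=
  ⋃ C ∈ {C : Set X | IsCozeroSet C ∧ P (closure C)},
    interior (closure (stoneCechUnit '' C))

/-- A pseudocompact space: every continuous real-valued function is bounded. -/
def Pseudocompact (Z : Type u) [TopologicalSpace Z] : Prop :=
  ∀ f : Z → ℝ, Continuous f → ∃ M, ∀ z, |f z| ≤ M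

/-- `P` is a topological property: it is invariant under homeomorphisms. -/
def TopProperty (P : (Z : Type u) → [TopologicalSpace Z] → Prop) : Prop :=
  ∀ (Z W : Type u) [TopologicalSpace Z] [TopologicalSpace W], Z ≃ₜ W → P Z → P W

/-- `P` is closed hereditary: closed subspaces of a space with `P` have `P`. -/
def ClosedHereditary (P : (Z : Type u) → [TopologicalSpace Z] → Prop) : Prop :=
  ∀ (Z : Type u) [TopologicalSpace Z], P Z → ∀ F : Set Z, IsClosed F → P F

/-- `P` is preserved under finite closed sums of subspaces. -/
def FiniteClosedSums (P : (Z : Type u) → [TopologicalSpace Z] → Prop) : Prop :=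
  ∀ (Z : Type u) [TopologicalSpace Z] [T2Space Z] (n : ℕ) (F : Fin n → Set Z),
    (∀ i, IsClosed (F i)) → (∀ i, P (F i)) → (⋃ i, F i) = univ → P Z

/-- `P` is preserved under locally finite closed sums of subspaces. -/
def LocallyFiniteClosedSums (P : (Z : Type u) → [TopologicalSpace Z] → Prop) : Prop :=
  ∀ (Z : Type u) [TopologicalSpace Z] [T2Space Z] (ι : Type u) (F : ι → Set Z),
    LocallyFinite F → (∀ i, IsClosed (F i)) → (∀ i, P (F i)) → (⋃ i, F i) = univ → P Z

/-- `P` is preserved under countable closed sums of subspaces. -/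
def CountableClosedSums (P : (Z : Type u) → [TopologicalSpace Z] → Prop) : Prop :=
  ∀ (Z : Type u) [TopologicalSpace Z] [T2Space Z] (F : ℕ → Set Z),
    (∀ i, IsClosed (F i)) → (∀ i, P (F i)) → (⋃ i, F i) = univ → P Z

/-- Mrówka's condition (W): if a Tychonoff space `T` has a point `p` with an open base `B` at
`p` such that `T \ b` has `P` for each `b ∈ B`, then `T` has `P`. -/
def MrowkaW (P : (Z : Type u) → [TopologicalSpace Z] → Prop) : Prop :=
  ∀ (T : Type u) [TopologicalSpace T] [T35Space T] (p : T) (B : Set (Set T)),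
    (∀ b ∈ B, IsOpen b ∧ p ∈ b) →
    (∀ V : Set T, IsOpen V → p ∈ V → ∃ b ∈ B, b ⊆ V) →
    (∀ b ∈ B, P (↥(bᶜ))) → P T

/-- `X` is locally-P: every point has an open neighborhood whose closure has `P`. -/
def LocallyP (P : (Z : Type u) → [TopologicalSpace Z] → Prop)
    (X : Type u) [TopologicalSpace X] : Prop :=
  ∀ x : X, ∃ U : Set X, IsOpen U ∧ x ∈ U ∧ P (closure U)

/-- `P` coincides with pseudocompactness. -/
def IsPseudocompactness (P : (Z : Type u) → [TopologicalSpace Z] → Prop) : Prop :=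
  ∀ (Z : Type u) [TopologicalSpace Z], P Z ↔ Pseudocompact Z

/-- A `P`-far one-point extension: for every zero-set `Z` of `X` contained in a cozero-set `C`
of `X` whose closure has `P`, the closure of `Z` in the extension misses the remainder. -/
def OnePointExt.PFar (P : (Z : Type u) → [TopologicalSpace Z] → Prop)
    (Y : OnePointExt X) : Prop :=
  ∀ Z C : Set X, IsZeroSet Z → IsCozeroSet C → P (closure C) → Z ⊆ C →
    Y.pt ∉ closure (Y.ι '' Z)

/-- Čech-complete: `Z` is a Gδ-set in `βZ`. -/
def CechComplete (Z : Type u) [TopologicalSpace Z] : Prop :=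
  IsGδ (Set.range (stoneCechUnit : Z → StoneCech Z))

/-- The extension is first countable at the added point. -/
def OnePointExt.FirstCountableAtPt (Y : OnePointExt X) : Prop :=
  (𝓝 Y.pt).IsCountablyGenerated

/-- Strong zero-dimensionality: `βX` has an open base of clopen sets. -/
def StronglyZeroDimensional (X : Type u) [TopologicalSpace X] : Prop :=
  ∀ U : Set (StoneCech X), IsOpen U → ∀ x ∈ U,
    ∃ V : Set (StoneCech X), IsClopen V ∧ x ∈ V ∧ V ⊆ U

/-- `Δ` is an order-isomorphism from the subset `A` of one-point extensions of `X` (with the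
order `≤`) onto the subset `B` of one-point extensions of `Y`, where extensions are regarded
up to the equivalence `OnePointExt.equiv`: `Δ` maps `A` into `B`, reflects and preserves `≤`
on `A`, and every member of `B` is equivalent to the image of a member of `A`. -/
def RestrictedOrderIso {X Y : Type u} [TopologicalSpace X] [TopologicalSpace Y]
    (A : Set (OnePointExt X)) (B : Set (OnePointExt Y))
    (Δ : OnePointExt X → OnePointExt Y) : Prop :=
  (∀ T ∈ A, Δ T ∈ B) ∧
  (∀ T1 ∈ A, ∀ T2 ∈ A, (T1.le T2 ↔ (Δ T1).le (Δ T2))) ∧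
  (∀ S ∈ B, ∃ T ∈ A, (Δ T).equiv S)

/-- The trace on `X` of the neighbourhood filter of the added point. -/
def OnePointExt.tr (Y : OnePointExt X) : Filter X := comap Y.ι (𝓝 Y.pt)

theorem OnePointExt.ι_ne (Y : OnePointExt X) (x : X) : Y.ι x ≠ Y.pt := by
  have h : Y.ι x ∈ Set.range Y.ι := ⟨x, rfl⟩
  rw [Y.range_eq] at h
  exact h

theorem OnePointExt.openEmb (Y : OnePointExt X) : IsOpenEmbedding Y.ι :=
  ⟨Y.emb, by rw [Y.range_eq]; exact isOpen_compl_singleton⟩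

theorem OnePointExt.exists_of_ne (Y : OnePointExt X) {y : Y.carrier} (h : y ≠ Y.pt) :
    ∃ x, Y.ι x = y := by
  have : y ∈ Set.range Y.ι := by rw [Y.range_eq]; exact h
  exact this

theorem OnePointExt.tr_neBot (Y : OnePointExt X) : Y.tr.NeBot := by
  have := Y.dense Y.pt
  rw [mem_closure_iff_comap_neBot] at this
  refine ⟨fun h => ?_⟩
  unfold OnePointExt.tr at h
  have h2 : ∅ ∈ comap Y.ι (𝓝 Y.pt) := by rw [h]; exact mem_bot
  obtain ⟨V, hV, hVs⟩ := h2
  obtain ⟨y, hy, x, rfl⟩ := mem_closure_iff_nhds.1 (Y.dense Y.pt) V hV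
  exact hVs hy

theorem OnePointExt.nhds_pt (Y : OnePointExt X) :
    𝓝 Y.pt = map Y.ι Y.tr ⊔ pure Y.pt := by
  rw [OnePointExt.tr, Filter.map_comap, Y.range_eq, ← nhdsWithin, nhdsNE_sup_pure]

theorem OnePointExt.tendsto_tr (Y : OnePointExt X) : Tendsto Y.ι Y.tr (𝓝 Y.pt) :=
  tendsto_comap

theorem OnePointExt.le_iff (Y1 Y2 : OnePointExt X) : Y1.le Y2 ↔ Y2.tr ≤ Y1.tr := by
  constructor
  · rintro ⟨f, hf, hfx⟩
    have hcomp : f ∘ Y2.ι = Y1.ι := funext hfx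
    have key : Y2.tr ≤ comap Y1.ι (𝓝 (f Y2.pt)) := by
      rw [← tendsto_iff_comap, ← hcomp]
      exact (hf.tendsto Y2.pt).comp Y2.tendsto_tr
    have hpt : f Y2.pt = Y1.pt := by
      by_contra hne
      obtain ⟨x, hx⟩ := Y1.exists_of_ne hne
      rw [← hx, ← Y1.emb.nhds_eq_comap] at key
      have := Y2.tr_neBot
      have h1 : Tendsto Y2.ι Y2.tr (𝓝 (Y2.ι x)) :=
        (Y2.emb.continuous.tendsto x).mono_left key
      exact Y2.ι_ne x (tendsto_nhds_unique h1 Y2.tendsto_tr)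
    rwa [hpt] at key
  · intro h
    classical
    refine ⟨Function.extend Y2.ι Y1.ι (fun _ => Y1.pt), ?_,
      fun x => Y2.emb.injective.extend_apply _ _ _⟩
    have hcomp : Function.extend Y2.ι Y1.ι (fun _ => Y1.pt) ∘ Y2.ι = Y1.ι :=
      funext fun x => Y2.emb.injective.extend_apply _ _ _
    have hpt : Function.extend Y2.ι Y1.ι (fun _ => Y1.pt) Y2.pt = Y1.pt :=
      Function.extend_apply' _ _ _ (by rintro ⟨x, hx⟩; exact Y2.ι_ne x hx)
    rw [continuous_iff_continuousAt]
    intro y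
    by_cases hy : y = Y2.pt
    · subst hy
      rw [ContinuousAt, hpt, Y2.nhds_pt]
      refine Tendsto.sup ?_ ?_
      · rw [tendsto_map'_iff, hcomp]
        exact Y1.tendsto_tr.mono_left h
      · rw [tendsto_pure_left]
        intro s hs
        rw [hpt]
        exact mem_of_mem_nhds hs
    · obtain ⟨x, rfl⟩ := Y2.exists_of_ne hy
      rw [ContinuousAt, ← Y2.openEmb.map_nhds_eq, tendsto_map'_iff, hcomp,
        Y2.emb.injective.extend_apply]
      exact Y1.emb.continuous.tendsto x

theorem OnePointExt.le_of_equiv {Y1 Y2 : OnePointExt X} (h : Y1.equiv Y2) :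
    Y2.le Y1 ∧ Y1.le Y2 := by
  obtain ⟨e, he⟩ := h
  refine ⟨⟨e, e.continuous, he⟩, ⟨e.symm, e.symm.continuous, fun x => ?_⟩⟩
  rw [← he, e.symm_apply_apply]

theorem OnePointExt.equiv_of_le {Y1 Y2 : OnePointExt X} (h12 : Y1.le Y2) (h21 : Y2.le Y1) :
    Y1.equiv Y2 := by
  obtain ⟨f, hf, hfx⟩ := h12
  obtain ⟨g, hg, hgx⟩ := h21
  have h1 : f ∘ g = id := Y1.dense.equalizer (hf.comp hg) continuous_id
    (funext fun x => by simp [hfx, hgx])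
  have h2 : g ∘ f = id := Y2.dense.equalizer (hg.comp hf) continuous_id
    (funext fun x => by simp [hfx, hgx])
  exact ⟨⟨⟨g, f, congrFun h1, congrFun h2⟩, hg, hf⟩, hgx⟩

/-- The topology on `Option X` with neighbourhood trace `G` at `none`. -/
def optTop (G : Filter X) : TopologicalSpace (Option X) where
  IsOpen U := IsOpen (some ⁻¹' U) ∧ (none ∈ U → some ⁻¹' U ∈ G)
  isOpen_univ := ⟨by simp, fun _ => by simp⟩
  isOpen_inter s t hs ht := ⟨hs.1.inter ht.1, fun h => inter_mem (hs.2 h.1) (ht.2 h.2)⟩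
  isOpen_sUnion S hS := by
    refine ⟨?_, ?_⟩
    · rw [preimage_sUnion]
      exact isOpen_biUnion fun t ht => (hS t ht).1
    · rintro ⟨t, ht, hn⟩
      exact mem_of_superset ((hS t ht).2 hn) (preimage_mono (subset_sUnion_of_mem ht))

theorem optTop_isOpen {G : Filter X} {U : Set (Option X)} :
    IsOpen[optTop G] U ↔ IsOpen (some ⁻¹' U) ∧ (none ∈ U → some ⁻¹' U ∈ G) := Iff.rfl

theorem optTop_continuous {G : Filter X} {Z : Type*} [TopologicalSpace Z] {f : X → Z} {c : Z}
    (hf : Continuous f) (hc : Tendsto f G (𝓝 c)) :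
    @Continuous _ _ (optTop G) _ (fun o : Option X => o.elim c f) := by
  letI := optTop G
  refine ⟨fun U hU => ?_⟩
  exact ⟨hU.preimage hf, fun h => hc (hU.mem_nhds h)⟩

theorem optTop_t35 [T2Space X] [LocallyCompactSpace X] {G : Filter X} (hco : G ≤ cocompact X)
    (hfun : ∀ S ∈ G, ∃ f : X → unitInterval, Continuous f ∧ (∀ x ∉ S, f x = 1) ∧
      Tendsto f G (𝓝 0)) : @T35Space _ (optTop G) := by
  letI := optTop G
  have hT1 : T1Space (Option X) := by
    refine ⟨fun o => ?_⟩
    rw [← isOpen_compl_iff]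
    cases o with
    | none =>
      refine ⟨?_, fun h => (h rfl).elim⟩
      have : (some ⁻¹' ({none}ᶜ : Set (Option X))) = univ := by ext; simp
      rw [this]; exact isOpen_univ
    | some x =>
      have : (some ⁻¹' ({some x}ᶜ : Set (Option X))) = {x}ᶜ := by ext; simp
      refine ⟨?_, fun _ => ?_⟩
      · rw [this]; exact isOpen_compl_singleton
      · rw [this]; exact hco isCompact_singleton.compl_mem_cocompact
  have hCR : CompletelyRegularSpace (Option X) := by
    refine ⟨fun o K hK ho => ?_⟩
    have hKo := optTop_isOpen.1 hK.isOpen_compl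
    cases o with
    | none =>
      obtain ⟨f, hf, hf1, hft⟩ := hfun _ (hKo.2 ho)
      refine ⟨_, optTop_continuous hf hft, rfl, ?_⟩
      rintro (_ | x) hx
      · exact (ho hx).elim
      · exact hf1 x (fun h => h hx)
    | some x =>
      obtain ⟨g, hg1, hgc, hgs, hg01⟩ := exists_continuousMap_one_of_isCompact_subset_isOpen
        (isCompact_singleton (x := x)) hKo.1 (singleton_subset_iff.2 ho)
      let f : X → unitInterval := fun y => ⟨1 - g y, by
        have := hg01 y; constructor <;> linarith [this.1, this.2]⟩
      have hf : Continuous f := by fun_prop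
      have hf1 : ∀ y ∉ tsupport g, f y = 1 := by
        intro y hy
        apply Subtype.ext
        simp [f, image_eq_zero_of_notMem_tsupport hy]
      have hft : Tendsto f G (𝓝 1) := by
        refine Tendsto.congr' ?_ tendsto_const_nhds
        filter_upwards [hco hgc.compl_mem_cocompact] with y hy
        exact (hf1 y hy).symm
      refine ⟨_, optTop_continuous hf hft, ?_, ?_⟩
      · apply Subtype.ext
        simp [f, hg1 (mem_singleton x)]
      · rintro (_ | y) hy
        · rfl
        · exact hf1 y (fun h => hgs h hy)
  exact {}

/-- The one-point extension with trace `G`. -/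
def optExt [T2Space X] [LocallyCompactSpace X] (G : Filter X) (hne : G.NeBot)
    (hco : G ≤ cocompact X)
    (hfun : ∀ S ∈ G, ∃ f : X → unitInterval, Continuous f ∧ (∀ x ∉ S, f x = 1) ∧
      Tendsto f G (𝓝 0)) : OnePointExt X where
  carrier := Option X
  top := optTop G
  t35 := optTop_t35 hco hfun
  ι := some
  emb := by
    letI := optTop G
    refine (IsOpenEmbedding.of_continuous_injective_isOpenMap ?_ (Option.some_injective X)
      ?_).isEmbedding
    · exact ⟨fun U hU => hU.1⟩
    · intro U hU
      refine ⟨?_, fun h => ?_⟩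
      · rwa [preimage_image_eq _ (Option.some_injective X)]
      · simp at h
  pt := none
  range_eq := by ext (_ | x) <;> simp
  dense := by
    letI := optTop G
    intro o
    cases o with
    | some x => exact subset_closure ⟨x, rfl⟩
    | none =>
      rw [mem_closure_iff]
      intro U hU hn
      obtain ⟨x, hx⟩ := hne.nonempty_of_mem (hU.2 hn)
      exact ⟨some x, hx, x, rfl⟩

theorem optExt_tr [T2Space X] [LocallyCompactSpace X] (G : Filter X) (hne : G.NeBot)
    (hco : G ≤ cocompact X)
    (hfun : ∀ S ∈ G, ∃ f : X → unitInterval, Continuous f ∧ (∀ x ∉ S, f x = 1) ∧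
      Tendsto f G (𝓝 0)) : (optExt G hne hco hfun).tr = G := by
  letI := optTop G
  have : (optExt G hne hco hfun).tr = comap (some : X → Option X) (𝓝 none) := rfl
  rw [this]
  apply le_antisymm
  · intro S hS
    obtain ⟨f, hf, hf1, hft⟩ := hfun S hS
    have hc := optTop_continuous hf hft
    have hopen : IsOpen {o : Option X | o.elim (0 : unitInterval) f ≠ 1} :=
      isOpen_compl_singleton.preimage hc
    refine ⟨_, hopen.mem_nhds ?_, ?_⟩
    · simp
    · intro x hx
      by_contra hxS
      exact hx (hf1 x hxS)
  · rintro S ⟨V, hV, hVS⟩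
    obtain ⟨U, hUV, hU, hn⟩ := mem_nhds_iff.1 hV
    exact mem_of_superset (hU.2 hn) ((preimage_mono hUV).trans hVS)

/-- `s` lies in a closed set having `P`. -/
def PSmall (P : (Z : Type u) → [TopologicalSpace Z] → Prop) (s : Set X) : Prop :=
  ∃ C : Set X, IsClosed C ∧ s ⊆ C ∧ P C

theorem P_of_small {P : (Z : Type u) → [TopologicalSpace Z] → Prop}
    (hProp : TopProperty P) (hHer : ClosedHereditary P) {A : Set X} (hA : IsClosed A)
    (h : PSmall P A) : P A := by
  obtain ⟨C, hC, hAC, hPC⟩ := h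
  have h1 := hHer C hPC (Subtype.val ⁻¹' A) (hA.preimage continuous_subtype_val)
  refine hProp _ _ ?_ h1
  exact
    { toFun := fun z => ⟨z.1.1, z.2⟩
      invFun := fun a => ⟨⟨a.1, hAC a.2⟩, a.2⟩
      left_inv := fun _ => rfl
      right_inv := fun _ => rfl
      continuous_toFun := by fun_prop
      continuous_invFun := by fun_prop }

theorem P_iUnion [T2Space X] {P : (Z : Type u) → [TopologicalSpace Z] → Prop}
    (hProp : TopProperty P)
    (hsum : LocallyFiniteClosedSums P ∨ CountableClosedSums P)
    {J : Type u} [Countable J] [Nonempty J] (A : J → Set X) (hlf : LocallyFinite A)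
    (hcl : ∀ i, IsClosed (A i)) (hP : ∀ i, P (A i)) : PSmall P (⋃ i, A i) := by
  refine ⟨⋃ i, A i, hlf.isClosed_iUnion hcl, Subset.rfl, ?_⟩
  have hcl' : ∀ i, IsClosed ((Subtype.val : (⋃ i, A i : Set X) → X) ⁻¹' A i) :=
    fun i => (hcl i).preimage continuous_subtype_val
  have hP' : ∀ i, P ((Subtype.val : (⋃ i, A i : Set X) → X) ⁻¹' A i) := by
    intro i
    refine hProp _ _ ?_ (hP i)
    exact
      { toFun := fun a => ⟨⟨a.1, mem_iUnion.2 ⟨i, a.2⟩⟩, a.2⟩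
        invFun := fun z => ⟨z.1.1, z.2⟩
        left_inv := fun _ => rfl
        right_inv := fun _ => rfl
        continuous_toFun := by fun_prop
        continuous_invFun := by fun_prop }
  have hU : ⋃ i, ((Subtype.val : (⋃ i, A i : Set X) → X) ⁻¹' A i) = univ := by
    ext z
    simpa using mem_iUnion.1 z.2
  rcases hsum with h | h
  · exact h _ J _ (hlf.preimage_continuous continuous_subtype_val) hcl' hP' hU
  · obtain ⟨e, he⟩ := exists_surjective_nat J
    refine h _ (fun n => (Subtype.val : (⋃ i, A i : Set X) → X) ⁻¹' A (e n))
      (fun n => hcl' _) (fun n => hP' _) ?_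
    rw [← hU]
    exact he.iUnion_comp (fun i => (Subtype.val : (⋃ i, A i : Set X) → X) ⁻¹' A i)

theorem PSmall.union [T2Space X] {P : (Z : Type u) → [TopologicalSpace Z] → Prop}
    (hProp : TopProperty P)
    (hsum : LocallyFiniteClosedSums P ∨ CountableClosedSums P) {s t : Set X}
    (hs : PSmall P s) (ht : PSmall P t) : PSmall P (s ∪ t) := by
  obtain ⟨C, hC, hsC, hPC⟩ := hs
  obtain ⟨D, hD, htD, hPD⟩ := ht
  obtain ⟨E, hE, hsub, hPE⟩ := P_iUnion hProp hsum
    (fun b : ULift.{u} Bool => if b.down then C else D) (locallyFinite_of_finite _)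
    (by rintro ⟨_ | _⟩ <;> simpa) (by rintro ⟨_ | _⟩ <;> simpa)
  refine ⟨E, hE, Subset.trans ?_ hsub, hPE⟩
  rintro x (hx | hx)
  · exact mem_iUnion.2 ⟨⟨true⟩, by simpa using hsC hx⟩
  · exact mem_iUnion.2 ⟨⟨false⟩, by simpa using htD hx⟩

theorem PSmall.mono {P : (Z : Type u) → [TopologicalSpace Z] → Prop} {s t : Set X}
    (hst : s ⊆ t) (ht : PSmall P t) : PSmall P s := by
  obtain ⟨C, hC, hsC, hPC⟩ := ht
  exact ⟨C, hC, hst.trans hsC, hPC⟩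

theorem PSmall.of_compact [T2Space X] [Nonempty X]
    {P : (Z : Type u) → [TopologicalSpace Z] → Prop}
    (hProp : TopProperty P) (hloc : LocallyP P X)
    (hsum : LocallyFiniteClosedSums P ∨ CountableClosedSums P) {K : Set X}
    (hK : IsCompact K) : PSmall P K := by
  have hx : ∀ x : X, ∃ U ∈ 𝓝 x, PSmall P U := by
    intro x
    obtain ⟨U, hU, hxU, hP⟩ := hloc x
    exact ⟨U, hU.mem_nhds hxU, closure U, isClosed_closure, subset_closure, hP⟩
  refine hK.induction_on ?_ (fun s t => PSmall.mono) (fun s t => PSmall.union hProp hsum) ?_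
  · obtain ⟨U, -, hU⟩ := hx (Classical.arbitrary X)
    exact hU.mono (empty_subset _)
  · intro x _
    obtain ⟨U, h1, h2⟩ := hx x
    exact ⟨U, mem_nhdsWithin_of_mem_nhds h1, h2⟩

theorem OnePointExt.nonempty (Y : OnePointExt X) : Nonempty X := by
  have := Y.tr_neBot
  exact Filter.nonempty_of_neBot Y.tr

/-- The witness that a set is away from the new point. -/
def Wit (P : (Z : Type u) → [TopologicalSpace Z] → Prop) (T : Filter X) (f : X → ℝ) : Prop :=
  Continuous f ∧ (∀ x, 0 ≤ f x) ∧ PSmall P (Function.support f) ∧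
    𝓟 (Function.support f) ⊓ cocompact X ≤ T

theorem wit_compact [T2Space X] [LocallyCompactSpace X] [Nonempty X]
    {P : (Z : Type u) → [TopologicalSpace Z] → Prop}
    (hProp : TopProperty P) (hloc : LocallyP P X)
    (hsum : LocallyFiniteClosedSums P ∨ CountableClosedSums P) (T : Filter X) {K : Set X}
    (hK : IsCompact K) : ∃ f, Wit P T f ∧ ∀ x ∈ K, 1 ≤ f x := by
  obtain ⟨g, hg1, hgc, -, hg01⟩ := exists_continuousMap_one_of_isCompact_subset_isOpen
    hK isOpen_univ (subset_univ _)
  refine ⟨g, ⟨g.continuous, fun x => (hg01 x).1,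
    (PSmall.of_compact hProp hloc hsum hgc).mono (subset_tsupport g), ?_⟩,
    fun x hx => by rw [hg1 hx]; rfl⟩
  have : 𝓟 (Function.support g) ⊓ cocompact X = ⊥ := by
    rw [← disjoint_iff, disjoint_principal_left]
    exact mem_of_superset hgc.compl_mem_cocompact (compl_subset_compl.2 (subset_tsupport g))
  rw [this]
  exact bot_le

theorem Wit.add [T2Space X] {P : (Z : Type u) → [TopologicalSpace Z] → Prop}
    (hProp : TopProperty P)
    (hsum : LocallyFiniteClosedSums P ∨ CountableClosedSums P) {T : Filter X} {f g : X → ℝ}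
    (hf : Wit P T f) (hg : Wit P T g) : Wit P T (fun x => f x + g x) := by
  have hsup : Function.support (fun x => f x + g x) ⊆
      Function.support f ∪ Function.support g := Function.support_add f g
  refine ⟨hf.1.add hg.1, fun x => add_nonneg (hf.2.1 x) (hg.2.1 x),
    (PSmall.union hProp hsum hf.2.2.1 hg.2.2.1).mono hsup, ?_⟩
  refine (inf_le_inf_right _ (principal_mono.2 hsup)).trans ?_
  rw [← sup_principal, inf_sup_right]
  exact sup_le hf.2.2.2 hg.2.2.2

theorem Wit.mul {P : (Z : Type u) → [TopologicalSpace Z] → Prop} {T : Filter X} {f : X → ℝ}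
    (hf : Wit P T f) {c : ℝ} (hc : 0 ≤ c) : Wit P T (fun x => c * f x) := by
  have hsup : Function.support (fun x => c * f x) ⊆ Function.support f := by
    intro x hx h
    exact hx (by simp [h])
  exact ⟨continuous_const.mul hf.1, fun x => mul_nonneg hc (hf.2.1 x), hf.2.2.1.mono hsup,
    (inf_le_inf_right _ (principal_mono.2 hsup)).trans hf.2.2.2⟩

/-- The trace filter of the new extension. -/
def newFilter [T2Space X] [LocallyCompactSpace X] [Nonempty X]
    {P : (Z : Type u) → [TopologicalSpace Z] → Prop}
    (hProp : TopProperty P) (hloc : LocallyP P X)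
    (hsum : LocallyFiniteClosedSums P ∨ CountableClosedSums P) (T : Filter X) : Filter X where
  sets := {S | ∃ f, Wit P T f ∧ ∀ x ∉ S, 1 ≤ f x}
  univ_sets := by
    obtain ⟨f, hf, -⟩ := wit_compact hProp hloc hsum T isCompact_empty
    exact ⟨f, hf, fun x hx => (hx (mem_univ x)).elim⟩
  sets_of_superset := by
    rintro S S' ⟨f, hf, h1⟩ hS
    exact ⟨f, hf, fun x hx => h1 x (fun h => hx (hS h))⟩
  inter_sets := by
    rintro S S' ⟨f, hf, h1⟩ ⟨g, hg, h2⟩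
    refine ⟨_, hf.add hProp hsum hg, fun x hx => ?_⟩
    by_cases hxS : x ∈ S
    · have := h2 x (fun h => hx ⟨hxS, h⟩)
      linarith [hf.2.1 x]
    · linarith [h1 x hxS, hg.2.1 x]

theorem mem_newFilter [T2Space X] [LocallyCompactSpace X] [Nonempty X]
    {P : (Z : Type u) → [TopologicalSpace Z] → Prop}
    {hProp : TopProperty P} {hloc : LocallyP P X}
    {hsum : LocallyFiniteClosedSums P ∨ CountableClosedSums P} {T : Filter X} {S : Set X} :
    S ∈ newFilter hProp hloc hsum T ↔ ∃ f, Wit P T f ∧ ∀ x ∉ S, 1 ≤ f x := Iff.rfl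

theorem exists_newExt [T2Space X] [LocallyCompactSpace X] [Nonempty X]
    {P : (Z : Type u) → [TopologicalSpace Z] → Prop}
    (hProp : TopProperty P) (hHer : ClosedHereditary P) (hloc : LocallyP P X) (hnP : ¬ P X)
    (hsum : LocallyFiniteClosedSums P ∨ CountableClosedSums P) (T : Filter X) :
    ∃ E : OnePointExt X, E.tr = newFilter hProp hloc hsum T := by
  have hne : (newFilter hProp hloc hsum T).NeBot := by
    refine ⟨fun h => ?_⟩
    have h0 : ∅ ∈ newFilter hProp hloc hsum T := by rw [h]; exact mem_bot
    obtain ⟨f, hf, h1⟩ := mem_newFilter.1 h0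
    have hU : PSmall P (univ : Set X) := hf.2.2.1.mono fun x _ => by
      have := h1 x (notMem_empty x)
      intro h
      rw [h] at this
      linarith
    exact hnP (hProp _ _ (Homeomorph.Set.univ X) (P_of_small hProp hHer isClosed_univ hU))
  refine ⟨optExt _ hne ?_ ?_, optExt_tr _ _ _ _⟩
  · intro S hS
    obtain ⟨K, hK, hKS⟩ := mem_cocompact.1 hS
    obtain ⟨f, hf, h1⟩ := wit_compact hProp hloc hsum T hK
    exact ⟨f, hf, fun x hx => h1 x (by by_contra h; exact hx (hKS h))⟩
  · rintro S ⟨f, hf, h1⟩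
    refine ⟨fun x => Set.projIcc 0 1 zero_le_one (f x), continuous_projIcc.comp hf.1,
      fun x hx => Set.projIcc_of_right_le _ (h1 x hx), ?_⟩
    have h0 : (0 : unitInterval) = Set.projIcc 0 1 zero_le_one (0 : ℝ) :=
      (Set.projIcc_of_le_left _ le_rfl).symm
    rw [h0]
    refine (continuous_projIcc.tendsto (0 : ℝ)).comp ?_
    rw [Metric.tendsto_nhds]
    intro ε hε
    refine ⟨_, hf.mul (inv_nonneg.2 hε.le), fun x hx => ?_⟩
    have hx' : ε ≤ f x := by
      by_contra h
      apply hx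
      simp only [mem_setOf_eq, Real.dist_eq, sub_zero, abs_of_nonneg (hf.2.1 x)]
      exact not_le.1 h
    rw [inv_mul_eq_div, one_le_div hε]
    exact hx'

theorem P_newExt [T2Space X] [LocallyCompactSpace X] [Nonempty X]
    {P : (Z : Type u) → [TopologicalSpace Z] → Prop}
    (hProp : TopProperty P) (hHer : ClosedHereditary P) (hW : MrowkaW P) (hloc : LocallyP P X)
    (hsum : LocallyFiniteClosedSums P ∨ CountableClosedSums P) (T : Filter X)
    (E : OnePointExt X) (hE : E.tr = newFilter hProp hloc hsum T) : P E.carrier := by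
  refine hW E.carrier E.pt {b | IsOpen b ∧ E.pt ∈ b} (fun b hb => hb)
    (fun V hV hp => ⟨V, ⟨hV, hp⟩, Subset.rfl⟩) ?_
  rintro b ⟨hb, hpb⟩
  have hS : E.ι ⁻¹' b ∈ E.tr := preimage_mem_comap (hb.mem_nhds hpb)
  rw [hE] at hS
  obtain ⟨f, hf, h1⟩ := mem_newFilter.1 hS
  have hcl : IsClosed (E.ι ⁻¹' bᶜ) := hb.isClosed_compl.preimage E.emb.continuous
  have hPA : P (E.ι ⁻¹' bᶜ) := by
    refine P_of_small hProp hHer hcl (hf.2.2.1.mono fun x hx => ?_)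
    have := h1 x hx
    intro h
    rw [h] at this
    linarith
  refine hProp _ _ ?_ hPA
  have hemb : IsEmbedding (fun a : E.ι ⁻¹' bᶜ => (⟨E.ι a.1, a.2⟩ : ↥bᶜ)) := by
    have h : IsEmbedding (fun a : E.ι ⁻¹' bᶜ => E.ι a.1) :=
      E.emb.comp IsEmbedding.subtypeVal
    exact h.codRestrict bᶜ (fun a => a.2)
  refine hemb.toHomeomorphOfSurjective ?_
  rintro ⟨y, hy⟩
  obtain ⟨x, rfl⟩ := E.exists_of_ne (y := y) (by rintro rfl; exact hy hpb)
  exact ⟨⟨x, hy⟩, rfl⟩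

theorem newFilter_mono [T2Space X] [LocallyCompactSpace X] [Nonempty X]
    {P : (Z : Type u) → [TopologicalSpace Z] → Prop}
    (hProp : TopProperty P) (hloc : LocallyP P X)
    (hsum : LocallyFiniteClosedSums P ∨ CountableClosedSums P) {T1 T2 : Filter X}
    (h : T2 ≤ T1) : newFilter hProp hloc hsum T1 ≤ newFilter hProp hloc hsum T2 := by
  rintro S ⟨f, hf, h1⟩
  exact ⟨f, ⟨hf.1, hf.2.1, hf.2.2.1, hf.2.2.2.trans h⟩, h1⟩

theorem newFilter_reflect [T2Space X] [LocallyCompactSpace X] [Nonempty X]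
    {P : (Z : Type u) → [TopologicalSpace Z] → Prop}
    (hProp : TopProperty P) (hHer : ClosedHereditary P) (hloc : LocallyP P X)
    (hsum : LocallyFiniteClosedSums P ∨ CountableClosedSums P) (Y1 Y2 : OnePointExt X)
    (hfc : Y2.FirstCountableAtPt)
    (h : newFilter hProp hloc hsum Y1.tr ≤ newFilter hProp hloc hsum Y2.tr) :
    Y2.tr ≤ Y1.tr := by
  intro V hV
  by_contra hVn
  have hfc' : (𝓝 Y2.pt).IsCountablyGenerated := hfc
  obtain ⟨W, hW⟩ := (𝓝 Y2.pt).exists_antitone_basis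
  -- open traces
  let U : ℕ → Set X := fun n => Y2.ι ⁻¹' interior (W n)
  have hUo : ∀ n, IsOpen (U n) := fun n => isOpen_interior.preimage Y2.emb.continuous
  have hUm : ∀ n, U n ∈ Y2.tr := fun n =>
    preimage_mem_comap (interior_mem_nhds.2 (hW.1.mem_of_mem trivial))
  have hUanti : Antitone U := fun m n hmn => preimage_mono (interior_mono (hW.2 hmn))
  have hUsmall : ∀ S ∈ Y2.tr, ∃ n, U n ⊆ S := by
    rintro S ⟨Q, hQ, hQS⟩
    obtain ⟨n, -, hn⟩ := hW.1.mem_iff.1 hQ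
    exact ⟨n, (preimage_mono (interior_subset.trans hn)).trans hQS⟩
  have hKc : ∀ K : Set X, IsCompact K → Kᶜ ∈ Y2.tr := by
    intro K hK
    have hcl : IsClosed (Y2.ι '' K) := (hK.image Y2.emb.continuous).isClosed
    refine ⟨(Y2.ι '' K)ᶜ, hcl.isOpen_compl.mem_nhds ?_, ?_⟩
    · rintro ⟨x, -, hx⟩
      exact Y2.ι_ne x hx
    · intro x hx hxK
      exact hx ⟨x, hxK, rfl⟩
  have hpick : ∀ n, ∃ x, x ∈ U n ∧ x ∉ V := by
    intro n
    by_contra hcon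
    push Not at hcon
    exact hVn (mem_of_superset (hUm n) hcon)
  choose x hxU hxV using hpick
  have hbump : ∀ n, ∃ g : C(X, ℝ), Set.EqOn g 1 {x n} ∧ IsCompact (tsupport g) ∧
      tsupport g ⊆ U n ∧ ∀ x, g x ∈ Set.Icc 0 1 := fun n =>
    exists_continuousMap_one_of_isCompact_subset_isOpen isCompact_singleton (hUo n)
      (singleton_subset_iff.2 (hxU n))
  choose g hg1 hgc hgs hg01 using hbump
  have hlf : LocallyFinite (fun n => tsupport (g n)) := by
    intro y
    obtain ⟨K, hK, hyK⟩ := exists_compact_mem_nhds y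
    obtain ⟨N, hN⟩ := hUsmall _ (hKc K hK)
    refine ⟨K, hyK, (Set.finite_lt_nat N).subset ?_⟩
    rintro n ⟨z, hz, hzK⟩
    by_contra hn
    exact hN (hUanti (not_lt.1 hn) (hgs n hz)) hzK
  have hlf' : LocallyFinite (fun n => Function.support (g n)) :=
    hlf.subset fun n => subset_tsupport (g n)
  let f : X → ℝ := fun y => ∑ᶠ n, g n y
  have hfin : ∀ y, (Function.support fun n => g n y).Finite := fun y => hlf'.point_finite y
  have hsup : Function.support f ⊆ ⋃ n, tsupport (g n) := by
    intro y hy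
    by_contra hcon
    apply hy
    have : ∀ n, g n y = 0 := fun n =>
      image_eq_zero_of_notMem_tsupport fun hn => hcon (mem_iUnion.2 ⟨n, hn⟩)
    simp [f, this]
  have hwit : Wit P Y2.tr f := by
    refine ⟨continuous_finsum (fun n => (g n).continuous) hlf',
      fun y => finsum_nonneg fun n => (hg01 n y).1, ?_, ?_⟩
    · have hlfu : LocallyFinite (fun n : ULift.{u} ℕ => tsupport (g n.down)) :=
        hlf.comp_injective ULift.down_injective
      refine (P_iUnion hProp hsum (fun n : ULift.{u} ℕ => tsupport (g n.down)) hlfu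
        (fun n => isClosed_tsupport _) (fun n => P_of_small hProp hHer (isClosed_tsupport _)
          (PSmall.of_compact hProp hloc hsum (hgc _)))).mono (hsup.trans ?_)
      exact iUnion_subset fun n => subset_iUnion_of_subset ⟨n⟩ Subset.rfl
    · intro S hS
      obtain ⟨N, hN⟩ := hUsmall S hS
      have hK : IsCompact (⋃ n ∈ Finset.range N, tsupport (g n)) :=
        (Finset.range N).isCompact_biUnion fun n _ => hgc n
      rw [mem_inf_iff_superset]
      refine ⟨_, mem_principal_self _, _, hK.compl_mem_cocompact, ?_⟩
      rintro y ⟨hy, hyK⟩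
      obtain ⟨n, hn⟩ := mem_iUnion.1 (hsup hy)
      by_cases hnN : n < N
      · exact (hyK (mem_biUnion (Finset.mem_coe.2 (Finset.mem_range.2 hnN)) hn)).elim
      · exact hN (hUanti (not_lt.1 hnN) (hgs n hn))
  have hmem : (Set.range x)ᶜ ∈ newFilter hProp hloc hsum Y2.tr := by
    refine ⟨f, hwit, fun y hy => ?_⟩
    obtain ⟨n, rfl⟩ := not_not.1 hy
    have h1 : g n (x n) = 1 := hg1 n rfl
    have h2 : g n (x n) ≤ f (x n) :=
      single_le_finsum n (hfin (x n)) (fun m => (hg01 m (x n)).1)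
    linarith
  obtain ⟨f', hf', h1⟩ := h hmem
  have h2 := hf'.2.2.2 hV
  obtain ⟨A, hA, B, hB, hAB⟩ := mem_inf_iff_superset.1 h2
  obtain ⟨K, hK, hKB⟩ := mem_cocompact.1 hB
  obtain ⟨N, hN⟩ := hUsmall _ (hKc K hK)
  refine hxV N (hAB ⟨hA ?_, hKB (hN (hxU N))⟩)
  have := h1 (x N) (fun hc => hc ⟨N, rfl⟩)
  intro h0
  rw [h0] at this
  linarith

/-- Let `X` be a locally compact, locally-P Tychonoff space not having `P`,
where `P` is a closed hereditary Mrówka topological property, and suppose that either `X` is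
paracompact and `P` is preserved under locally finite closed sums of subspaces, or `P` is
preserved under countable closed sums of subspaces.  Then `(E_P(X), ≤)` contains an
anti-order-isomorphic copy of `(E*(X), ≤)`: there is a map `F` from one-point extensions to
one-point extensions which sends (the class of) every extension first countable at the added
point to (the class of) an extension with `P`, is injective on equivalence classes, and
satisfies `Y₁ ≤ Y₂ ↔ F Y₂ ≤ F Y₁` on `E*(X)`. -/
theorem stmt14 {X : Type u} [TopologicalSpace X] [T35Space X] [LocallyCompactSpace X]
    (P : (Z : Type u) → [TopologicalSpace Z] → Prop)
    (hProp : TopProperty P) (hHer : ClosedHereditary P) (hW : MrowkaW P)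
    (hloc : LocallyP P X) (hnP : ¬ P X)
    (hsum : (ParacompactSpace X ∧ LocallyFiniteClosedSums P) ∨ CountableClosedSums P) :
    ∃ F : OnePointExt X → OnePointExt X,
      (∀ Y : OnePointExt X, Y.FirstCountableAtPt → P (F Y).carrier) ∧
      (∀ Y1 Y2 : OnePointExt X, Y1.FirstCountableAtPt → Y2.FirstCountableAtPt →
        ((F Y1).equiv (F Y2) → Y1.equiv Y2)) ∧
      (∀ Y1 Y2 : OnePointExt X, Y1.FirstCountableAtPt → Y2.FirstCountableAtPt →
        (Y1.le Y2 ↔ (F Y2).le (F Y1))) := by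
  have hs : LocallyFiniteClosedSums P ∨ CountableClosedSums P := hsum.imp_left And.right
  have hex : ∀ Y : OnePointExt X, ∃ E : OnePointExt X, E.tr =
      (haveI := Y.nonempty; newFilter hProp hloc hs Y.tr) := by
    intro Y
    haveI := Y.nonempty
    exact exists_newExt hProp hHer hloc hnP hs Y.tr
  choose F hF using hex
  have hord : ∀ Y1 Y2 : OnePointExt X, Y1.FirstCountableAtPt → Y2.FirstCountableAtPt →
      (Y1.le Y2 ↔ (F Y2).le (F Y1)) := by
    intro Y1 Y2 _ h2
    haveI := Y1.nonempty
    rw [OnePointExt.le_iff, OnePointExt.le_iff, hF, hF]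
    exact ⟨newFilter_mono hProp hloc hs, newFilter_reflect hProp hHer hloc hs Y1 Y2 h2⟩
  refine ⟨F, ?_, ?_, hord⟩
  · intro Y _
    haveI := Y.nonempty
    exact P_newExt hProp hHer hW hloc hs Y.tr (F Y) (hF Y)
  · intro Y1 Y2 h1 h2 he
    obtain ⟨ha, hb⟩ := OnePointExt.le_of_equiv he
    exact OnePointExt.equiv_of_le ((hord Y1 Y2 h1 h2).2 ha) ((hord Y2 Y1 h2 h1).2 hb)
end

section
/- Let X and Y be locally compact, locally-P Tychonoff spaces not having P, where P is either pseudocompactness or a closed hereditary Mrówka topological property preserved under finite closed sums of subspaces. Then every order-isomorphism from (E_P(X), ≤) onto (E_P(Y), ≤) restricts to an order-isomorphism from (E^C_P(X), ≤) onto (E^C_P(Y), ≤); conversely, every order-isomorphism from (E^C_P(X), ≤) onto (E^C_P(Y), ≤) extends to an order-isomorphism from (E_P(X), ≤) onto (E_P(Y), ≤). -/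
open Set Topology Filter

universe u

variable {X : Type u} [TopologicalSpace X]

section AbstractOrder

/-- Order isomorphism between subsets of two orders. -/
def OIso {L M : Type*} [LE L] [LE M] (A : Set L) (B : Set M) (φ : L → M) : Prop :=
  (∀ a ∈ A, φ a ∈ B) ∧ (∀ a ∈ A, ∀ b ∈ A, (a ≤ b ↔ φ a ≤ φ b)) ∧ ∀ b ∈ B, ∃ a ∈ A, φ a = b

/-- Abstract pair (all admissible elements, Lindelof admissible elements). -/
structure Sys {L : Type*} [CompleteLattice L] (E C : Set L) : Prop where
  sub : C ⊆ E
  infE : ∀ S ⊆ E, S.Nonempty → sInf S ∈ E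
  infC : ∀ S ⊆ C, S.Nonempty → S.Countable → sInf S ∈ C
  lind : ∀ c ∈ C, ∀ S ⊆ E, S.Nonempty → sInf S ≤ c →
    ∃ S' ⊆ S, S'.Nonempty ∧ S'.Countable ∧ sInf S' ≤ c
  base : ∀ e ∈ E, sInf {c | c ∈ C ∧ e ≤ c} ≤ e
  ne : ∀ e ∈ E, ∃ c ∈ C, e ≤ c

variable {L M : Type*} [CompleteLattice L] [CompleteLattice M]
  {E C : Set L} {E' C' : Set M} {φ : L → M}

theorem Sys.memC (h : Sys E C) {e : L} (he : e ∈ E)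
    (hl : ∀ S ⊆ E, S.Nonempty → sInf S ≤ e →
      ∃ S' ⊆ S, S'.Nonempty ∧ S'.Countable ∧ sInf S' ≤ e) : e ∈ C := by
  obtain ⟨c, hc, hec⟩ := h.ne e he
  obtain ⟨S', hS', hn, hcount, hle⟩ := hl {c | c ∈ C ∧ e ≤ c} (fun x hx => h.sub hx.1)
    ⟨c, hc, hec⟩ (h.base e he)
  have : e = sInf S' := le_antisymm (le_sInf fun x hx => (hS' hx).2) hle
  rw [this]
  exact h.infC _ (fun x hx => (hS' hx).1) hn hcount

theorem OIso.sInf_eq (h : Sys E C) (h' : Sys E' C') (hφ : OIso E E' φ) {S : Set L}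
    (hS : S ⊆ E) (hn : S.Nonempty) : φ (sInf S) = sInf (φ '' S) := by
  have h1 := h.infE S hS hn
  have h2 : sInf (φ '' S) ∈ E' := by
    apply h'.infE _ _ (hn.image _)
    rintro _ ⟨x, hx, rfl⟩
    exact hφ.1 x (hS hx)
  apply le_antisymm
  · apply le_sInf
    rintro _ ⟨x, hx, rfl⟩
    exact (hφ.2.1 _ h1 _ (hS hx)).1 (sInf_le hx)
  · obtain ⟨a, ha, hae⟩ := hφ.2.2 _ h2
    rw [← hae]
    apply (hφ.2.1 _ ha _ h1).1
    apply le_sInf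
    intro x hx
    rw [hφ.2.1 _ ha _ (hS hx), hae]
    exact sInf_le ⟨x, hx, rfl⟩

theorem OIso.restrict (h : Sys E C) (h' : Sys E' C') (hφ : OIso E E' φ) : OIso C C' φ := by
  have key : ∀ a ∈ E, (a ∈ C ↔ φ a ∈ C') := by
    intro a ha
    constructor
    · intro hac
      apply h'.memC (hφ.1 a ha)
      intro S hS hn hle
      set T : Set L := {x | x ∈ E ∧ φ x ∈ S} with hT
      have hTS : φ '' T = S := by
        ext y
        constructor
        · rintro ⟨x, hx, rfl⟩
          exact hx.2
        · intro hy
          obtain ⟨x, hx, rfl⟩ := hφ.2.2 y (hS hy)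
          exact ⟨x, ⟨hx, hy⟩, rfl⟩
      have hTE : T ⊆ E := fun x hx => hx.1
      have hTn : T.Nonempty := by
        rw [← hTS] at hn
        exact hn.of_image
      have h1 : sInf T ≤ a := by
        rw [hφ.2.1 _ (h.infE T hTE hTn) _ ha, hφ.sInf_eq h h' hTE hTn, hTS]
        exact hle
      obtain ⟨T', hT', hn', hc', hle'⟩ := h.lind a hac T hTE hTn h1
      refine ⟨φ '' T', ?_, hn'.image _, hc'.image _, ?_⟩
      · rw [← hTS]
        exact image_mono hT'
      · rw [← hφ.sInf_eq h h' (hT'.trans hTE) hn']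
        exact (hφ.2.1 _ (h.infE _ (hT'.trans hTE) hn') _ ha).1 hle'
    · intro hac
      apply h.memC ha
      intro S hS hn hle
      have hSE : φ '' S ⊆ E' := by
        rintro _ ⟨x, hx, rfl⟩
        exact hφ.1 x (hS hx)
      obtain ⟨T', hT', hn', hc', hle'⟩ := h'.lind _ hac (φ '' S) hSE (hn.image _) (by
        rw [← hφ.sInf_eq h h' hS hn]
        exact (hφ.2.1 _ (h.infE S hS hn) _ ha).1 hle)
      obtain ⟨S', hS', hcS', rfl⟩ : ∃ S' ⊆ S, S'.Countable ∧ φ '' S' = T' := by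
        obtain ⟨S', hS', hbij⟩ := exists_subset_bijOn (s := φ ⁻¹' T' ∩ S) φ
        refine ⟨S', fun x hx => (hS' hx).2, ?_, ?_⟩
        · apply countable_of_injective_of_countable_image hbij.injOn
          rw [hbij.image_eq]
          exact hc'.mono (by rintro _ ⟨x, hx, rfl⟩; exact hx.1)
        · rw [hbij.image_eq]
          apply Subset.antisymm
          · rintro _ ⟨x, hx, rfl⟩
            exact hx.1
          · intro y hy
            obtain ⟨x, hx, rfl⟩ := hT' hy
            exact ⟨x, ⟨hy, hx⟩, rfl⟩
      have hn'' := hn'.of_image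
      refine ⟨S', hS', hn'', hcS', ?_⟩
      rw [hφ.2.1 _ (h.infE _ (hS'.trans hS) hn'') _ ha, hφ.sInf_eq h h' (hS'.trans hS) hn'']
      exact hle'
  refine ⟨fun a ha => (key a (h.sub ha)).1 ha,
    fun a ha b hb => hφ.2.1 a (h.sub ha) b (h.sub hb), fun b hb => ?_⟩
  obtain ⟨a, ha, rfl⟩ := hφ.2.2 b (h'.sub hb)
  exact ⟨a, (key a ha).2 hb, rfl⟩

theorem OIso.extend (h : Sys E C) (h' : Sys E' C') (hφ : OIso C C' φ) :
    ∃ ψ : L → M, OIso E E' ψ ∧ ∀ c ∈ C, ψ c = φ c := by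
  set up : L → Set L := fun e => {c | c ∈ C ∧ e ≤ c} with hup
  have upn : ∀ e ∈ E, (up e).Nonempty := fun e he => by
    obtain ⟨c, hc, hec⟩ := h.ne e he
    exact ⟨c, hc, hec⟩
  have imE : ∀ e, φ '' (up e) ⊆ E' := by
    rintro e _ ⟨x, hx, rfl⟩
    exact h'.sub (hφ.1 x hx.1)
  -- key : if `T ⊆ C` and `inf φ T ≤ φ c` then `inf T ≤ c`.
  have key : ∀ T ⊆ C, T.Nonempty → ∀ c ∈ C, sInf (φ '' T) ≤ φ c → sInf T ≤ c := by
    intro T hT hn c hc hle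
    obtain ⟨S, hS, hSn, hSc, hSle⟩ := h'.lind (φ c) (hφ.1 c hc) (φ '' T)
      (by rintro _ ⟨x, hx, rfl⟩; exact h'.sub (hφ.1 x (hT hx))) (hn.image _) hle
    have : ∀ s : S, ∃ t ∈ T, φ t = s := fun s => hS s.2
    choose g hgT hg using this
    have hgr : (range g).Nonempty := by
      obtain ⟨s, hs⟩ := hSn
      exact ⟨g ⟨s, hs⟩, mem_range_self _⟩
    have : Countable S := hSc
    have hgC : range g ⊆ C := by
      rintro _ ⟨s, rfl⟩
      exact hT (hgT s)
    have hm := h.infC _ hgC hgr (countable_range g)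
    have h1 : sInf (range g) ≤ c := by
      rw [hφ.2.1 _ hm _ hc]
      refine le_trans (le_sInf fun s hs => ?_) hSle
      refine le_trans ?_ (hg ⟨s, hs⟩).le
      exact (hφ.2.1 _ hm _ (hgC (mem_range_self _))).1 (sInf_le (mem_range_self _))
    refine le_trans (le_sInf ?_) h1
    rintro _ ⟨s, rfl⟩
    exact sInf_le (hgT s)
  refine ⟨fun e => sInf (φ '' (up e)), ⟨?_, ?_, ?_⟩, ?_⟩
  · intro e he
    exact h'.infE _ (imE e) ((upn e he).image _)
  · intro a ha b hb
    constructor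
    · intro hab
      exact sInf_le_sInf (image_mono fun c hc => ⟨hc.1, hab.trans hc.2⟩)
    · intro hab
      refine le_trans (le_sInf fun c hc => ?_) (h.base b hb)
      refine le_trans (le_sInf fun x hx => hx.2) (key (up a) (fun x hx => hx.1) (upn a ha) c hc.1
        (hab.trans (sInf_le ⟨c, hc, rfl⟩)))
  · intro s hs
    set T : Set L := {c | c ∈ C ∧ s ≤ φ c} with hT
    have hTC : T ⊆ C := fun x hx => hx.1
    have hTn : T.Nonempty := by
      obtain ⟨c', hc', hle⟩ := h'.ne s hs
      obtain ⟨c, hc, rfl⟩ := hφ.2.2 c' hc'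
      exact ⟨c, hc, hle⟩
    refine ⟨sInf T, h.infE T (hTC.trans h.sub) hTn, ?_⟩
    apply le_antisymm
    · refine le_trans (le_sInf ?_) (h'.base s hs)
      rintro c' ⟨hc', hle⟩
      obtain ⟨c, hc, rfl⟩ := hφ.2.2 c' hc'
      exact sInf_le ⟨c, ⟨hc, sInf_le ⟨hc, hle⟩⟩, rfl⟩
    · apply le_sInf
      rintro _ ⟨c, ⟨hc, hle⟩, rfl⟩
      obtain ⟨S, hS, hSn, hSc, hSle⟩ := h.lind c hc T (hTC.trans h.sub) hTn hle
      have hm : sInf (φ '' S) ∈ C' := h'.infC _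
        (by rintro _ ⟨x, hx, rfl⟩; exact hφ.1 x (hTC (hS hx))) (hSn.image _) (hSc.image _)
      obtain ⟨d, hd, hde⟩ := hφ.2.2 _ hm
      have hdc : d ≤ c := by
        refine le_trans (le_sInf fun x hx => ?_) hSle
        rw [hφ.2.1 d hd x (hTC (hS hx)), hde]
        exact sInf_le ⟨x, hx, rfl⟩
      rw [hφ.2.1 d hd c hc, hde] at hdc
      refine le_trans (le_sInf ?_) hdc
      rintro _ ⟨x, hx, rfl⟩
      exact (hS hx).2
  · intro c hc
    apply le_antisymm
    · exact sInf_le ⟨c, ⟨hc, le_rfl⟩, rfl⟩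
    · apply le_sInf
      rintro _ ⟨x, hx, rfl⟩
      exact (hφ.2.1 c hc x hx.1).1 hx.2

end AbstractOrder

section FilterSystem

/-- Abstract smallness notion for (closed) subsets of `X`. -/
structure SmallSets (X : Type u) [TopologicalSpace X] (Q : Set X → Prop) : Prop where
  empty : Q ∅
  union : ∀ A B, IsClosed A → IsClosed B → Q A → Q B → Q (A ∪ B)
  mono : ∀ A B, IsClosed A → IsClosed B → A ⊆ B → Q B → Q A
  compact : ∀ A, IsCompact A → Q A
  univ : ¬ Q univ

/-- Complete regularity of a filter. -/
def CRFilter (F : Filter X) : Prop :=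
  ∀ A ∈ F, ∃ f : X → ℝ, Continuous f ∧ Tendsto f F (𝓝 0) ∧ ∀ x ∉ A, 1 ≤ f x

/-- Filters which are traces of one-point extensions. -/
structure ExtFilter (F : Filter X) : Prop where
  neBot : F.NeBot
  le : F ≤ cocompact X
  cr : CRFilter F

/-- Filters corresponding to extensions with `P`. -/
def FE (Q : Set X → Prop) : Set (Filter X) :=
  {F | ExtFilter F ∧ ∀ A, IsClosed A → Aᶜ ∈ F → Q A}

/-- Filters corresponding to Cech-complete extensions. -/
def CechF (F : Filter X) : Prop :=
  ∃ G : Filter X, G.IsCountablyGenerated ∧ F = cocompact X ⊓ G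

theorem CRFilter.iInf {ι : Type*} {f : ι → Filter X} (h : ∀ i, CRFilter (f i)) :
    CRFilter (⨅ i, f i) := by
  intro A hA
  refine Filter.iInf_sets_induct
    (p := fun A => ∃ g : X → ℝ, Continuous g ∧ Tendsto g (⨅ i, f i) (𝓝 0) ∧ ∀ x ∉ A, 1 ≤ g x)
    hA ?_ ?_
  · exact ⟨fun _ => 0, continuous_const, tendsto_const_nhds, fun x hx => absurd (mem_univ x) hx⟩
  · rintro i s t hs ⟨g, hgc, hgt, hg⟩
    obtain ⟨k, hkc, hkt, hk⟩ := h i s hs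
    refine ⟨fun x => max (k x) (g x), hkc.max hgc, ?_, ?_⟩
    · have := (hkt.mono_left (iInf_le f i)).max hgt
      simpa using this
    · intro x hx
      by_cases hxs : x ∈ s
      · exact le_max_of_le_right (hg x fun hxt => hx ⟨hxs, hxt⟩)
      · exact le_max_of_le_left (hk x hxs)

theorem CRFilter.sInf {S : Set (Filter X)} (h : ∀ F ∈ S, CRFilter F) : CRFilter (sInf S) := by
  rw [sInf_eq_iInf']
  exact CRFilter.iInf fun i => h i i.2

theorem CRFilter.inf {F G : Filter X} (hF : CRFilter F) (hG : CRFilter G) :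
    CRFilter (F ⊓ G) := by
  rw [← sInf_pair]
  apply CRFilter.sInf
  rintro H (rfl | rfl) <;> assumption

theorem CRFilter.cocompact [T35Space X] [LocallyCompactSpace X] :
    CRFilter (cocompact X) := by
  intro A hA
  obtain ⟨K, hK, hKA⟩ := mem_cocompact.1 hA
  obtain ⟨f, hf1, -, hfc, hf⟩ :=
    exists_continuous_one_zero_of_isCompact hK isClosed_empty (disjoint_empty K)
  refine ⟨f, f.continuous, ?_, ?_⟩
  · apply tendsto_const_nhds.congr'
    have h1 : (tsupport f)ᶜ ∈ Filter.cocompact X := hfc.isCompact.compl_mem_cocompact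
    filter_upwards [h1] with x hx
    exact (image_eq_zero_of_notMem_tsupport hx).symm
  · intro x hx
    have : x ∈ K := by
      by_contra h
      exact hx (hKA h)
    simp [hf1 this]

theorem CRFilter.comap {f : X → ℝ} (hf : Continuous f) : CRFilter (comap f (𝓝 0)) := by
  intro A hA
  obtain ⟨U, hU, hUA⟩ := mem_comap.1 hA
  obtain ⟨ε, hε, hεU⟩ := Metric.mem_nhds_iff.1 hU
  refine ⟨fun x => |f x| / ε, by fun_prop, ?_, ?_⟩
  · have h1 : Tendsto f (Filter.comap f (𝓝 0)) (𝓝 0) := tendsto_comap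
    simpa using (h1.abs).div_const ε
  · intro x hx
    rw [le_div_iff₀ hε, one_mul]
    by_contra hlt
    apply hx
    apply hUA
    apply hεU
    simpa using hlt

theorem FE.small_of_sInf {Q : Set X → Prop} (hQ : SmallSets X Q) {S : Set (Filter X)}
    (hS : S ⊆ FE Q) {A : Set X} (hA : IsClosed A) (hAS : Aᶜ ∈ sInf S) : Q A := by
  rw [sInf_eq_iInf'] at hAS
  have := Filter.iInf_sets_induct (p := fun s : Set X => ∀ A, IsClosed A → A ⊆ sᶜ → Q A)
    hAS ?_ ?_
  · exact this A hA (by simp)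
  · intro A _ hA
    have : A = ∅ := by simpa using hA
    rw [this]
    exact hQ.empty
  · intro i s t hs ht A hA hAst
    obtain ⟨g, hgc, hgt, hg⟩ := (hS i.2).1.cr s hs
    have hc1 : IsClosed (A ∩ {x | 1 / 2 ≤ g x}) := hA.inter (isClosed_le continuous_const hgc)
    have hc2 : IsClosed (A ∩ {x | g x ≤ 1 / 2}) := hA.inter (isClosed_le hgc continuous_const)
    have e : A = (A ∩ {x | 1 / 2 ≤ g x}) ∪ (A ∩ {x | g x ≤ 1 / 2}) := by
      rw [← inter_union_distrib_left]
      symm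
      apply inter_eq_left.2
      intro x _
      exact le_total (1 / 2) (g x)
    rw [e]
    apply hQ.union _ _ hc1 hc2
    · apply (hS i.2).2 _ hc1
      have : ∀ᶠ x in i.1, g x < 1 / 2 := hgt.eventually (gt_mem_nhds (by norm_num))
      filter_upwards [this] with x hx hx'
      exact absurd hx'.2 (not_le.2 hx)
    · apply ht _ hc2
      intro x hx hxt
      apply hAst hx.1
      refine ⟨?_, hxt⟩
      by_contra hxs
      have := hg x hxs
      have h2 : g x ≤ 1 / 2 := hx.2
      linarith

theorem FE.infE {Q : Set X → Prop} (hQ : SmallSets X Q) {S : Set (Filter X)}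
    (hS : S ⊆ FE Q) (hn : S.Nonempty) : sInf S ∈ FE Q := by
  refine ⟨⟨⟨fun hb => ?_⟩, ?_, ?_⟩, fun A hA hAS => FE.small_of_sInf hQ hS hA hAS⟩
  · apply hQ.univ
    apply FE.small_of_sInf hQ hS isClosed_univ
    rw [hb]
    exact mem_bot
  · obtain ⟨F, hF⟩ := hn
    exact (sInf_le hF).trans (hS hF).1.le
  · exact CRFilter.sInf fun F hF => (hS hF).1.cr

theorem FE.upward {Q : Set X → Prop} {F G : Filter X} (hF : F ∈ FE Q)
    (hG : ExtFilter G) (h : F ≤ G) : G ∈ FE Q :=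
  ⟨hG, fun A hA hAG => hF.2 A hA (h hAG)⟩

theorem CechF.sInf {S : Set (Filter X)} (hS : ∀ F ∈ S, CechF F) (hn : S.Nonempty)
    (hc : S.Countable) : CechF (sInf S) := by
  choose! G hG hFG using hS
  have : Countable S := hc
  refine ⟨⨅ i : S, G i, ?_, ?_⟩
  · have : ∀ i : S, (G i).IsCountablyGenerated := fun i => hG i i.2
    infer_instance
  · have : Nonempty S := hn.to_subtype
    rw [sInf_eq_iInf', inf_iInf]
    exact iInf_congr fun i => hFG i i.2

theorem sInf_countable_mem {S : Set (Filter X)} {A : Set X} (hA : A ∈ sInf S) :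
    ∃ S' ⊆ S, S'.Countable ∧ A ∈ sInf S' := by
  rw [sInf_eq_iInf'] at hA
  refine Filter.iInf_sets_induct (p := fun A => ∃ S' ⊆ S, S'.Countable ∧ A ∈ InfSet.sInf S')
    hA ?_ ?_
  · exact ⟨∅, empty_subset _, countable_empty, univ_mem⟩
  · rintro i s t hs ⟨S', h1, h2, h3⟩
    refine ⟨insert i.1 S', insert_subset i.2 h1, h2.insert _, ?_⟩
    apply inter_mem
    · exact (sInf_le (mem_insert i.1 S') : InfSet.sInf (insert i.1 S') ≤ i.1) hs
    · exact (sInf_le_sInf (subset_insert i.1 S') : InfSet.sInf (insert i.1 S') ≤ _) h3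

theorem FE.sys [T35Space X] [LocallyCompactSpace X] {Q : Set X → Prop} (hQ : SmallSets X Q) :
    Sys (FE Q) {F | F ∈ FE Q ∧ CechF F} where
  sub := fun F hF => hF.1
  infE := fun S hS hn => FE.infE hQ hS hn
  infC := fun S hS hn hc => ⟨FE.infE hQ (fun F hF => (hS hF).1) hn,
    CechF.sInf (fun F hF => (hS hF).2) hn hc⟩
  lind := by
    rintro c ⟨hc, G, hG, hcG⟩ S hS ⟨s₀, hs₀⟩ hle
    obtain ⟨B, hB⟩ := G.exists_antitone_basis
    have h1 : ∀ n, B n ∈ sInf S := fun n => hle (by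
      rw [hcG]
      exact mem_inf_of_right (hB.1.mem_of_mem trivial))
    choose T hTS hTc hT using fun n => sInf_countable_mem (h1 n)
    refine ⟨insert s₀ (⋃ n, T n), insert_subset hs₀ (iUnion_subset hTS), insert_nonempty _ _,
      (countable_iUnion hTc).insert _, ?_⟩
    rw [hcG]
    apply le_inf
    · exact (sInf_le (mem_insert _ _)).trans (hS hs₀).1.le
    · rw [hB.1.ge_iff]
      intro n _
      exact sInf_le_sInf ((subset_iUnion T n).trans (subset_insert _ _)) (hT n)
  base := by
    intro F hF A hA
    obtain ⟨f, hfc, hft, hf⟩ := hF.1.cr A hA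
    have hle : F ≤ cocompact X ⊓ comap f (𝓝 0) := le_inf hF.1.le hft.le_comap
    have hG : ExtFilter (cocompact X ⊓ comap f (𝓝 0)) :=
      ⟨hF.1.neBot.mono hle, inf_le_left, CRFilter.cocompact.inf (CRFilter.comap hfc)⟩
    have hm : cocompact X ⊓ comap f (𝓝 0) ∈ {c | c ∈ {F | F ∈ FE Q ∧ CechF F} ∧ F ≤ c} :=
      ⟨⟨FE.upward hF hG hle, _, inferInstance, rfl⟩, hle⟩
    apply sInf_le hm
    apply mem_inf_of_right
    refine ⟨Iio 1, Iio_mem_nhds one_pos, ?_⟩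
    intro x hx
    by_contra hxA
    exact absurd (hf x hxA) (not_le.2 hx)
  ne := by
    intro F hF
    have hG : ExtFilter (cocompact X) :=
      ⟨hF.1.neBot.mono hF.1.le, le_rfl, CRFilter.cocompact⟩
    exact ⟨cocompact X, ⟨FE.upward hF hG hF.1.le, ⊤, inferInstance, by simp⟩, hF.1.le⟩

end FilterSystem

section Extensions

namespace OnePointExt

/-- Trace on `X` of the neighborhood filter of the added point. -/
def trace (T : OnePointExt X) : Filter X := comap T.ι (𝓝 T.pt)

theorem ι_ne_s15 (T : OnePointExt X) (x : X) : T.ι x ≠ T.pt := by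
  have : T.ι x ∈ range T.ι := mem_range_self x
  rw [T.range_eq] at this
  exact this

theorem eq_ι (T : OnePointExt X) {t : T.carrier} (h : t ≠ T.pt) : ∃ x, T.ι x = t := by
  have : t ∈ range T.ι := by
    rw [T.range_eq]
    exact h
  exact this

theorem openEmb_s15 (T : OnePointExt X) : IsOpenEmbedding T.ι :=
  ⟨T.emb, by rw [T.range_eq]; exact isOpen_compl_singleton⟩

theorem trace_neBot (T : OnePointExt X) : T.trace.NeBot := by
  apply Filter.comap_neBot
  intro V hV
  obtain ⟨_, hy, x, rfl⟩ := mem_closure_iff_nhds.1 (T.dense T.pt) V hV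
  exact ⟨x, hy⟩

theorem trace_ext (T : OnePointExt X) : ExtFilter T.trace where
  neBot := T.trace_neBot
  le := by
    intro A hA
    obtain ⟨K, hK, hKA⟩ := mem_cocompact.1 hA
    have hc : IsClosed (T.ι '' K) := (hK.image T.emb.continuous).isClosed
    refine ⟨(T.ι '' K)ᶜ, hc.isOpen_compl.mem_nhds ?_, ?_⟩
    · rintro ⟨x, -, hx⟩
      exact T.ι_ne_s15 x hx
    · intro x hx
      exact hKA fun hxK => hx (mem_image_of_mem _ hxK)
  cr := by
    intro A hA
    obtain ⟨V, hV, hVA⟩ := mem_comap.1 hA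
    obtain ⟨W, hWV, hW, hpW⟩ := mem_nhds_iff.1 hV
    obtain ⟨f, hf, hf0, hf1⟩ :=
      CompletelyRegularSpace.completely_regular_isOpen T.pt W hW hpW
    refine ⟨fun x => (f (T.ι x) : ℝ), by have := T.emb.continuous; fun_prop, ?_, ?_⟩
    · have h1 : Tendsto (fun t => (f t : ℝ)) (𝓝 T.pt) (𝓝 0) := by
        have : Continuous fun t => (f t : ℝ) := by fun_prop
        simpa [hf0] using this.tendsto T.pt
      exact h1.comp tendsto_comap
    · intro x hx
      have : T.ι x ∈ Wᶜ := fun h => hx (hVA (hWV h))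
      simp [hf1 this]

theorem le_iff_s15 (T₁ T₂ : OnePointExt X) : T₁.le T₂ ↔ T₂.trace ≤ T₁.trace := by
  constructor
  · rintro ⟨f, hf, hfι⟩
    have hNB := T₂.trace_neBot
    have ht2 : Tendsto T₂.ι T₂.trace (𝓝 T₂.pt) := tendsto_comap
    have ht1 : Tendsto T₁.ι T₂.trace (𝓝 (f T₂.pt)) := by
      have := (hf.tendsto T₂.pt).comp ht2
      refine this.congr hfι
    have hpt : f T₂.pt = T₁.pt := by
      by_contra hne
      obtain ⟨x, hx⟩ := T₁.eq_ι hne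
      rw [← hx] at ht1
      have h1 : T₂.trace ≤ 𝓝 x := by
        rw [T₁.emb.nhds_eq_comap]
        exact ht1.le_comap
      have h2 : Tendsto T₂.ι T₂.trace (𝓝 (T₂.ι x)) :=
        (T₂.emb.continuous.tendsto x).mono_left h1
      exact T₂.ι_ne_s15 x (tendsto_nhds_unique h2 ht2)
    rw [hpt] at ht1
    exact ht1.le_comap
  · intro h
    classical
    let f : T₂.carrier → T₁.carrier := fun t =>
      if ht : t = T₂.pt then T₁.pt else T₁.ι (T₂.eq_ι ht).choose
    have hfι : ∀ x, f (T₂.ι x) = T₁.ι x := by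
      intro x
      have hne := T₂.ι_ne_s15 x
      simp only [f, dif_neg hne]
      congr 1
      exact T₂.emb.injective (T₂.eq_ι hne).choose_spec
    have hfp : f T₂.pt = T₁.pt := by simp [f]
    refine ⟨f, ?_, hfι⟩
    rw [continuous_iff_continuousAt]
    intro t
    by_cases ht : t = T₂.pt
    · subst ht
      intro V hV
      rw [hfp] at hV
      have h1 : T₁.ι ⁻¹' V ∈ T₂.trace := h (preimage_mem_comap hV)
      obtain ⟨W, hW, hWV⟩ := mem_comap.1 h1
      rw [mem_map]
      filter_upwards [hW] with s hs
      by_cases hsp : s = T₂.pt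
      · subst hsp
        change f T₂.pt ∈ V
        rw [hfp]
        exact mem_of_mem_nhds hV
      · obtain ⟨x, rfl⟩ := T₂.eq_ι hsp
        change f (T₂.ι x) ∈ V
        rw [hfι]
        exact hWV hs
    · obtain ⟨x, rfl⟩ := T₂.eq_ι ht
      rw [← T₂.openEmb_s15.continuousAt_iff]
      have : f ∘ T₂.ι = T₁.ι := funext hfι
      rw [this]
      exact T₁.emb.continuous.continuousAt

theorem equiv_iff (T₁ T₂ : OnePointExt X) : T₁.equiv T₂ ↔ T₁.trace = T₂.trace := by
  constructor
  · rintro ⟨h, hh⟩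
    apply le_antisymm
    · rw [← le_iff_s15]
      exact ⟨h, h.continuous, hh⟩
    · rw [← le_iff_s15]
      exact ⟨h.symm, h.symm.continuous, fun x => by rw [← hh x, h.symm_apply_apply]⟩
  · intro h
    obtain ⟨f, hf, hfι⟩ := (le_iff_s15 T₁ T₂).2 h.ge
    obtain ⟨g, hg, hgι⟩ := (le_iff_s15 T₂ T₁).2 h.le
    have h1 : f ∘ g = id := T₁.dense.equalizer (hf.comp hg) continuous_id
      (funext fun x => by simp [hfι, hgι])
    have h2 : g ∘ f = id := T₂.dense.equalizer (hg.comp hf) continuous_id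
      (funext fun x => by simp [hfι, hgι])
    exact ⟨⟨⟨g, f, congrFun h1, congrFun h2⟩, hg, hf⟩, hgι⟩

/-- Topology on `Option X` defined by a filter. -/
@[reducible] def optTop (F : Filter X) : TopologicalSpace (Option X) where
  IsOpen U := IsOpen (some ⁻¹' U) ∧ (none ∈ U → some ⁻¹' U ∈ F)
  isOpen_univ := ⟨isOpen_univ, fun _ => univ_mem⟩
  isOpen_inter U V hU hV := ⟨hU.1.inter hV.1, fun h => inter_mem (hU.2 h.1) (hV.2 h.2)⟩
  isOpen_sUnion S hS := by
    rw [preimage_sUnion]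
    refine ⟨isOpen_biUnion fun t ht => (hS t ht).1, ?_⟩
    rintro ⟨t, ht, hn⟩
    exact mem_of_superset ((hS t ht).2 hn) (subset_biUnion_of_mem (u := fun t => some ⁻¹' t) ht)

theorem optTop_cont {F : Filter X} {Z : Type*} [TopologicalSpace Z] {h : Option X → Z}
    (h1 : Continuous fun x => h (some x)) (h2 : Tendsto (fun x => h (some x)) F (𝓝 (h none))) :
    @Continuous _ _ (optTop F) _ h := by
  let _ := optTop F
  rw [continuous_def]
  intro U hU
  exact ⟨h1.isOpen_preimage U hU, fun hn => h2 (hU.mem_nhds hn)⟩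

theorem optTop_trace {F : Filter X} (hF : ExtFilter F) :
    comap some (@nhds _ (optTop F) none) = F := by
  let _ := optTop F
  apply le_antisymm
  · intro A hA
    obtain ⟨f, hfc, hft, hf⟩ := hF.cr A hA
    refine ⟨insert none (some '' {x | f x < 1}), IsOpen.mem_nhds ?_ (mem_insert _ _), ?_⟩
    · have e : (some ⁻¹' insert none (some '' {x | f x < 1}) : Set X) = {x | f x < 1} := by
        ext x
        simp
      change IsOpen _ ∧ (_ → _ ∈ F)
      rw [e]
      exact ⟨isOpen_lt hfc continuous_const, fun _ => hft.eventually (gt_mem_nhds one_pos)⟩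
    · intro x hx
      have hx' : f x < 1 := by simpa using hx
      by_contra hxA
      exact absurd (hf x hxA) (not_le.2 hx')
  · intro A hA
    obtain ⟨V, hV, hVA⟩ := mem_comap.1 hA
    obtain ⟨W, hWV, hW, hn⟩ := mem_nhds_iff.1 hV
    exact mem_of_superset (hW.2 hn) fun x hx => hVA (hWV hx)

theorem optTop_emb (F : Filter X) : @IsEmbedding X _ _ (optTop F) some := by
  let _ := optTop F
  apply IsOpenEmbedding.isEmbedding
  apply IsOpenEmbedding.of_continuous_injective_isOpenMap
  · rw [continuous_def]
    exact fun U hU => hU.1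
  · exact Option.some_injective _
  · intro U hU
    refine ⟨?_, ?_⟩
    · rw [preimage_image_eq _ (Option.some_injective _)]
      exact hU
    · rintro ⟨x, -, hx⟩
      cases hx

theorem optTop_t35 [T35Space X] [LocallyCompactSpace X] {F : Filter X} (hF : ExtFilter F) :
    @T35Space _ (optTop F) := by
  let _ := optTop F
  have hT1 : T1Space (Option X) := by
    refine ⟨fun t => ?_⟩
    rw [← isOpen_compl_iff]
    cases t with
    | none =>
      refine ⟨?_, fun h => absurd rfl h⟩
      convert isOpen_univ
      ext x
      simp
    | some x =>
      have e : (some ⁻¹' {some x}ᶜ : Set X) = {x}ᶜ := by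
        ext y
        simp
      change IsOpen _ ∧ (_ → _ ∈ F)
      rw [e]
      exact ⟨isOpen_compl_singleton, fun _ => hF.le isCompact_singleton.compl_mem_cocompact⟩
  have hCR : CompletelyRegularSpace (Option X) := by
    rw [completelyRegularSpace_iff_isOpen]
    intro t U hU ht
    cases t with
    | none =>
      obtain ⟨f, hfc, hft, hf⟩ := hF.cr _ (hU.2 ht)
      refine ⟨fun o => o.elim 0 fun x => projIcc 0 1 zero_le_one (f x), ?_, rfl, ?_⟩
      · apply optTop_cont
        · exact continuous_projIcc.comp hfc
        · have : Tendsto (fun x => projIcc (0 : ℝ) 1 zero_le_one (f x)) F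
              (𝓝 (projIcc (0 : ℝ) 1 zero_le_one 0)) := (continuous_projIcc.tendsto 0).comp hft
          rw [projIcc_left] at this
          exact this
      · intro o ho
        cases o with
        | none => exact absurd ht ho
        | some x => exact projIcc_of_right_le zero_le_one (hf x ho)
    | some y =>
      obtain ⟨g, hg1, hg0, hgc, hg⟩ := exists_continuous_one_zero_of_isCompact
        (isCompact_singleton (x := y)) hU.1.isClosed_compl
        (by rw [disjoint_singleton_left]; exact fun h => h ht)
      refine ⟨fun o => o.elim 1 fun x => projIcc 0 1 zero_le_one (1 - g x), ?_, ?_, ?_⟩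
      · apply optTop_cont
        · have := g.continuous
          exact continuous_projIcc.comp (by fun_prop)
        · apply tendsto_const_nhds.congr'
          have h1 : (tsupport g)ᶜ ∈ F := hF.le hgc.isCompact.compl_mem_cocompact
          filter_upwards [h1] with x hx
          have : g x = 0 := image_eq_zero_of_notMem_tsupport hx
          simp [this]
      · have : g y = 1 := hg1 rfl
        simp [this]
      · intro o ho
        cases o with
        | none => rfl
        | some x =>
          have : g x = 0 := hg0 ho
          simp [this]
  exact {}

/-- Extension realizing a filter. -/
def ofFilter [T35Space X] [LocallyCompactSpace X] (F : Filter X) (hF : ExtFilter F) :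
    OnePointExt X where
  carrier := Option X
  top := optTop F
  t35 := optTop_t35 hF
  ι := some
  emb := optTop_emb F
  pt := none
  range_eq := by
    ext o
    cases o <;> simp
  dense := by
    let _ := optTop F
    intro o
    rw [mem_closure_iff]
    intro U hU ho
    cases o with
    | none =>
      have := hF.neBot
      obtain ⟨x, hx⟩ := Filter.nonempty_of_mem (hU.2 ho)
      exact ⟨some x, hx, mem_range_self x⟩
    | some x => exact ⟨some x, ho, mem_range_self x⟩

theorem exists_trace [T35Space X] [LocallyCompactSpace X] {F : Filter X} (hF : ExtFilter F) :
    ∃ T : OnePointExt X, T.trace = F :=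
  ⟨ofFilter F hF, optTop_trace hF⟩

end OnePointExt

end Extensions

section PropertyP

namespace OnePointExt

theorem closed_image (T : OnePointExt X) {A : Set X} (hA : IsClosed A) (hAT : Aᶜ ∈ T.trace) :
    IsClosed (T.ι '' A) := by
  rw [← isOpen_compl_iff, isOpen_iff_mem_nhds]
  intro t ht
  by_cases htp : t = T.pt
  · subst htp
    obtain ⟨V, hV, hVA⟩ := mem_comap.1 hAT
    filter_upwards [hV]
    rintro _ hs ⟨x, hx, rfl⟩
    exact hVA hs hx
  · obtain ⟨x, rfl⟩ := T.eq_ι htp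
    have hx : x ∉ A := fun h => ht ⟨x, h, rfl⟩
    have h1 : T.ι '' Aᶜ ∈ 𝓝 (T.ι x) :=
      (T.openEmb_s15.isOpenMap _ hA.isOpen_compl).mem_nhds ⟨x, hx, rfl⟩
    filter_upwards [h1]
    rintro _ ⟨y, hy, rfl⟩ ⟨z, hz, hzy⟩
    rw [T.emb.injective hzy] at hz
    exact hy hz

end OnePointExt

theorem TopProperty.image {P : (Z : Type u) → [TopologicalSpace Z] → Prop} (hP : TopProperty P)
    {Z W : Type u} [TopologicalSpace Z] [TopologicalSpace W] {e : Z → W} (he : IsEmbedding e)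
    (A : Set Z) : P A ↔ P (e '' A) :=
  ⟨fun h => hP _ _ (he.homeomorphImage A) h, fun h => hP _ _ (he.homeomorphImage A).symm h⟩

theorem smallSets_mrowka [T35Space X]
    {P : (Z : Type u) → [TopologicalSpace Z] → Prop} (hProp : TopProperty P)
    (hC : ClosedHereditary P) (hF : FiniteClosedSums P) (hloc : LocallyP P X) (hn : ¬ P X) :
    SmallSets X (fun A => P A) := by
  have hmono : ∀ A B : Set X, IsClosed A → A ⊆ B → P B → P A := by
    intro A B hA hAB hB
    have h1 := hC B hB (Subtype.val ⁻¹' A) (hA.preimage continuous_subtype_val)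
    rw [hProp.image IsEmbedding.subtypeVal, Subtype.image_preimage_coe,
      inter_eq_right.2 hAB] at h1
    exact h1
  have hempty : P (∅ : Set X) := by
    refine hF _ 0 (fun _ => ∅) (fun _ => isClosed_empty) (fun i => i.elim0) ?_
    ext z
    exact absurd z.2 (notMem_empty _)
  have hunion : ∀ A B : Set X, IsClosed A → IsClosed B → P A → P B → P (A ∪ B : Set X) := by
    intro A B hA hB hPA hPB
    have h1 : ∀ D : Set X, D ⊆ A ∪ B → P D → P (Subtype.val ⁻¹' D : Set (A ∪ B : Set X)) := by
      intro D hD hPD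
      rw [hProp.image IsEmbedding.subtypeVal, Subtype.image_preimage_coe, inter_eq_right.2 hD]
      exact hPD
    refine hF _ 2 ![Subtype.val ⁻¹' A, Subtype.val ⁻¹' B] ?_ ?_ ?_
    · exact Fin.forall_fin_two.2 ⟨hA.preimage continuous_subtype_val,
        hB.preimage continuous_subtype_val⟩
    · exact Fin.forall_fin_two.2 ⟨h1 A subset_union_left hPA, h1 B subset_union_right hPB⟩
    · apply eq_univ_of_forall
      rintro ⟨z, hz | hz⟩
      · exact mem_iUnion.2 ⟨0, by simpa using hz⟩
      · exact mem_iUnion.2 ⟨1, by simpa using hz⟩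
  refine ⟨hempty, hunion, fun A B hA _ => hmono A B hA, ?_, ?_⟩
  · intro A hA
    obtain ⟨B, hB, hAB, hPB⟩ := hA.induction_on
      (p := fun S => ∃ B, IsClosed B ∧ S ⊆ B ∧ P B)
      ⟨∅, isClosed_empty, Subset.rfl, hempty⟩
      (fun s t hst ⟨B, hB, h, hP⟩ => ⟨B, hB, hst.trans h, hP⟩)
      (fun s t ⟨B, hB, h, hP⟩ ⟨B', hB', h', hP'⟩ =>
        ⟨B ∪ B', hB.union hB', union_subset_union h h', hunion _ _ hB hB' hP hP'⟩)
      (fun x _ => by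
        obtain ⟨U, hU, hxU, hPU⟩ := hloc x
        exact ⟨U, mem_nhdsWithin_of_mem_nhds (hU.mem_nhds hxU), closure U, isClosed_closure,
          subset_closure, hPU⟩)
    exact hmono A B hA.isClosed hAB hPB
  · intro h
    exact hn (hProp _ _ (Homeomorph.Set.univ X) h)

theorem mem_FE_mrowka {P : (Z : Type u) → [TopologicalSpace Z] → Prop} (hProp : TopProperty P)
    (hC : ClosedHereditary P) (hW : MrowkaW P) (T : OnePointExt X) :
    P T.carrier ↔ T.trace ∈ FE (fun A : Set X => P A) := by
  constructor
  · intro hT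
    refine ⟨T.trace_ext, fun A hA hAT => ?_⟩
    change P A
    rw [hProp.image T.emb]
    exact hC _ hT _ (T.closed_image hA hAT)
  · rintro ⟨-, h⟩
    refine hW T.carrier T.pt {b | IsOpen b ∧ T.pt ∈ b} (fun b hb => hb)
      (fun V hV hp => ⟨V, ⟨hV, hp⟩, Subset.rfl⟩) ?_
    rintro b ⟨hb, hp⟩
    have h1 : P (T.ι ⁻¹' bᶜ : Set X) := by
      apply h _ (hb.isClosed_compl.preimage T.emb.continuous)
      rw [← preimage_compl, compl_compl]
      exact preimage_mem_comap (hb.mem_nhds hp)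
    rw [hProp.image T.emb, image_preimage_eq_of_subset] at h1
    · exact h1
    · rw [T.range_eq]
      intro t ht htp
      exact ht (by rw [htp]; exact hp)

/-- Relatively pseudocompact (bounded) subsets. -/
def BddSet (A : Set X) : Prop := ∀ f : X → ℝ, Continuous f → ∃ M, ∀ x ∈ A, |f x| ≤ M

theorem smallSets_pseudo (hn : ¬ Pseudocompact X) :
    SmallSets X (BddSet : Set X → Prop) := by
  refine ⟨fun f _ => ⟨0, fun x hx => absurd hx (notMem_empty x)⟩, ?_, ?_, ?_, ?_⟩
  · intro A B _ _ hA hB f hf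
    obtain ⟨M, hM⟩ := hA f hf
    obtain ⟨N, hN⟩ := hB f hf
    refine ⟨max M N, ?_⟩
    rintro x (hx | hx)
    · exact le_max_of_le_left (hM x hx)
    · exact le_max_of_le_right (hN x hx)
  · intro A B _ _ hAB hB f hf
    obtain ⟨M, hM⟩ := hB f hf
    exact ⟨M, fun x hx => hM x (hAB hx)⟩
  · intro A hA f hf
    exact hA.exists_bound_of_continuousOn hf.continuousOn
  · intro h
    apply hn
    intro f hf
    obtain ⟨M, hM⟩ := h f hf
    exact ⟨M, fun x => hM x (mem_univ x)⟩

theorem mem_FE_pseudo (T : OnePointExt X) :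
    Pseudocompact T.carrier ↔ T.trace ∈ FE (BddSet : Set X → Prop) := by
  constructor
  · intro hT
    refine ⟨T.trace_ext, fun A hA hAT f hf => ?_⟩
    have hc := T.closed_image hA hAT
    obtain ⟨h, hh, hh0, hh1⟩ := CompletelyRegularSpace.completely_regular T.pt _ hc (by
      rintro ⟨x, -, hx⟩
      exact T.ι_ne_s15 x hx)
    let k : T.carrier → ℝ := fun t => max (2 * (h t : ℝ) - 1) 0
    have hk : Continuous k := by fun_prop
    let G : T.carrier → ℝ := fun t => k t * Function.extend T.ι f 0 t
    have hGι : ∀ x, G (T.ι x) = k (T.ι x) * f x := fun x => by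
      simp only [G, T.emb.injective.extend_apply]
    have hG : Continuous G := by
      rw [continuous_iff_continuousAt]
      intro t
      by_cases ht : t = T.pt
      · subst ht
        have hev : ∀ᶠ t in 𝓝 T.pt, (h t : ℝ) < 1 / 2 := by
          have h1 : Tendsto (fun t => (h t : ℝ)) (𝓝 T.pt) (𝓝 0) := by
            have : Continuous fun t => (h t : ℝ) := by fun_prop
            simpa [hh0] using this.tendsto T.pt
          exact h1.eventually (gt_mem_nhds (by norm_num))
        have : (fun _ => (0 : ℝ)) =ᶠ[𝓝 T.pt] G := by
          filter_upwards [hev] with t ht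
          have : k t = 0 := max_eq_right (by linarith)
          simp [G, this]
        exact continuousAt_const.congr this
      · obtain ⟨x, rfl⟩ := T.eq_ι ht
        rw [← T.openEmb_s15.continuousAt_iff]
        have : G ∘ T.ι = fun x => k (T.ι x) * f x := funext hGι
        rw [this]
        have := T.emb.continuous
        exact Continuous.continuousAt (by fun_prop)
    obtain ⟨M, hM⟩ := hT G hG
    refine ⟨M, fun x hx => ?_⟩
    have h1 : h (T.ι x) = 1 := hh1 (mem_image_of_mem _ hx)
    have h2 := hM (T.ι x)
    rw [hGι] at h2
    have h3 : k (T.ι x) = 1 := by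
      simp only [k, h1]
      norm_num
    simpa [h3] using h2
  · rintro ⟨-, h⟩ g hg
    set N : Set T.carrier := {t | |g t - g T.pt| < 1} with hN
    have hNo : IsOpen N := isOpen_lt (by fun_prop) continuous_const
    obtain ⟨M, hM⟩ := h (T.ι ⁻¹' Nᶜ) (hNo.isClosed_compl.preimage T.emb.continuous) (by
      rw [← preimage_compl, compl_compl]
      exact preimage_mem_comap (hNo.mem_nhds (by simp [hN]))) (fun x => g (T.ι x))
      (hg.comp T.emb.continuous)
    refine ⟨max M (|g T.pt| + 1), fun t => ?_⟩
    by_cases ht : t ∈ N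
    · apply le_max_of_le_right
      have h1 : |g t - g T.pt| < 1 := ht
      have h2 := abs_sub_abs_le_abs_sub (g t) (g T.pt)
      linarith
    · apply le_max_of_le_left
      have htp : t ≠ T.pt := by
        rintro rfl
        exact ht (by simp [hN])
      obtain ⟨x, rfl⟩ := T.eq_ι htp
      exact hM x ht

end PropertyP

section Cech

theorem isOpen_range_of_locallyCompact [LocallyCompactSpace X] {Z : Type*} [TopologicalSpace Z]
    [T2Space Z] {e : X → Z} (he : IsEmbedding e) (hd : DenseRange e) : IsOpen (range e) := by
  rw [isOpen_iff_mem_nhds]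
  rintro _ ⟨x, rfl⟩
  obtain ⟨K, hK, hxK⟩ := exists_compact_mem_nhds x
  rw [he.nhds_eq_comap] at hxK
  obtain ⟨V, hV, hVK⟩ := mem_comap.1 hxK
  obtain ⟨W, hWV, hW, hxW⟩ := mem_nhds_iff.1 hV
  filter_upwards [hW.mem_nhds hxW] with z hz
  have h1 : z ∈ closure (W ∩ range e) := hd.open_subset_closure_inter hW hz
  have h2 : W ∩ range e ⊆ e '' K := by
    rintro _ ⟨hw, y, rfl⟩
    exact ⟨y, hVK (hWV hw), rfl⟩
  have h3 : IsClosed (e '' K) := (hK.image he.continuous).isClosed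
  exact image_subset_range _ _ (closure_minimal h2 h3 h1)

theorem cech_iff [LocallyCompactSpace X] (T : OnePointExt X) :
    CechComplete T.carrier ↔ CechF T.trace := by
  have hb : IsEmbedding (stoneCechUnit : T.carrier → StoneCech T.carrier) :=
    isEmbedding_stoneCechUnit
  set b : T.carrier → StoneCech T.carrier := stoneCechUnit with hbdef
  have hj : IsEmbedding (b ∘ T.ι) := hb.comp T.emb
  have hjd : DenseRange (b ∘ T.ι) := denseRange_stoneCechUnit.comp T.dense hb.continuous
  have hjo : IsOpen (range (b ∘ T.ι)) := isOpen_range_of_locallyCompact hj hjd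
  have hjt : Tendsto (b ∘ T.ι) T.trace (𝓝 (b T.pt)) :=
    (hb.continuous.tendsto _).comp tendsto_comap
  have hrange : ∀ q ∈ range b, q = b T.pt ∨ q ∈ range (b ∘ T.ι) := by
    rintro _ ⟨t, rfl⟩
    by_cases ht : t = T.pt
    · exact Or.inl (by rw [ht])
    · obtain ⟨x, rfl⟩ := T.eq_ι ht
      exact Or.inr ⟨x, rfl⟩
  have htr : T.trace = comap (b ∘ T.ι) (𝓝 (b T.pt)) := by
    rw [← comap_comap, ← hb.nhds_eq_comap]
    rfl
  constructor
  · intro h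
    obtain ⟨O, hO, hOe⟩ := isGδ_iff_eq_iInter_nat.1 h
    have h1 : ∀ n, ∃ N ∈ 𝓝 (b T.pt), IsClosed N ∧ N ⊆ O n := fun n =>
      exists_mem_nhds_isClosed_subset ((hO n).mem_nhds (by
        have : b T.pt ∈ ⋂ n, O n := hOe ▸ mem_range_self _
        exact mem_iInter.1 this n))
    choose N hN hNc hNO using h1
    refine ⟨⨅ n, 𝓟 ((b ∘ T.ι) ⁻¹' N n), inferInstance, le_antisymm ?_ ?_⟩
    · refine le_inf T.trace_ext.le (le_iInf fun n => ?_)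
      rw [le_principal_iff]
      exact hjt (hN n)
    · intro B hB
      rw [htr] at hB
      obtain ⟨W', hW', hWB'⟩ := mem_comap.1 hB
      obtain ⟨W, hWW, hW, hpW⟩ := mem_nhds_iff.1 hW'
      have hR : IsOpen (range (b ∘ T.ι) ∪ W) := hjo.union hW
      obtain ⟨u, hu⟩ := hR.isClosed_compl.isCompact.elim_finite_subfamily_closed N hNc (by
        rw [eq_empty_iff_forall_notMem]
        rintro q ⟨hq1, hq2⟩
        apply hq1
        have : q ∈ range b := by
          change q ∈ range (stoneCechUnit : T.carrier → StoneCech T.carrier)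
          rw [hOe]
          exact iInter_mono hNO hq2
        rcases hrange q this with rfl | h
        · exact Or.inr hpW
        · exact Or.inl h)
      set D : Set (StoneCech T.carrier) := (⋂ i ∈ u, N i) \ W with hD
      have hDc : IsCompact D :=
        ((isClosed_biInter fun i _ => hNc i).inter hW.isClosed_compl).isCompact
      have hDr : D ⊆ range (b ∘ T.ι) := by
        rintro q ⟨hq1, hq2⟩
        by_contra hq
        have : q ∈ (range (b ∘ T.ι) ∪ W)ᶜ ∩ ⋂ i ∈ u, N i :=
          ⟨fun h => h.elim hq hq2, hq1⟩
        rw [hu] at this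
        exact this
      have hK : IsCompact ((b ∘ T.ι) ⁻¹' D) := hj.isInducing.isCompact_preimage' hDc hDr
      have hA : (⋂ i ∈ u, (b ∘ T.ι) ⁻¹' N i) ∈ ⨅ n, 𝓟 ((b ∘ T.ι) ⁻¹' N n) := by
        rw [biInter_finset_mem]
        intro i _
        exact mem_iInf_of_mem i (mem_principal_self _)
      filter_upwards [mem_inf_of_left hK.compl_mem_cocompact, mem_inf_of_right hA] with x hx1 hx2
      apply hWB'
      apply hWW
      by_contra hxW
      apply hx1
      refine ⟨?_, hxW⟩
      simpa using hx2
  · rintro ⟨G, hG, hTG⟩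
    obtain ⟨B, hB⟩ := G.exists_antitone_basis
    have h1 : ∀ n, ∃ M : Set (StoneCech T.carrier), IsOpen M ∧ b T.pt ∈ M ∧
        (b ∘ T.ι) ⁻¹' M ⊆ B n := by
      intro n
      have : B n ∈ T.trace := by
        rw [hTG]
        exact mem_inf_of_right (hB.1.mem_of_mem trivial)
      rw [htr] at this
      obtain ⟨V, hV, hVB⟩ := mem_comap.1 this
      obtain ⟨M, hMV, hM, hp⟩ := mem_nhds_iff.1 hV
      exact ⟨M, hM, hp, fun x hx => hVB (hMV hx)⟩
    choose M hM hpM hMB using h1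
    apply isGδ_iff_eq_iInter_nat.2
    refine ⟨fun n => range (b ∘ T.ι) ∪ M n, fun n => hjo.union (hM n), ?_⟩
    apply Subset.antisymm
    · intro q hq
      rw [mem_iInter]
      intro n
      rcases hrange q hq with rfl | h
      · exact Or.inr (hpM n)
      · exact Or.inl h
    · intro q hq
      rw [mem_iInter] at hq
      by_contra hqb
      have hqj : q ∉ range (b ∘ T.ι) := fun ⟨x, hx⟩ => hqb ⟨T.ι x, hx⟩
      have hqM : ∀ n, q ∈ M n := fun n => (hq n).resolve_left hqj
      have hqp : b T.pt ≠ q := fun h => hqb ⟨T.pt, h⟩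
      obtain ⟨N, hN, hNc, hNq⟩ := exists_mem_nhds_isClosed_subset
        (isOpen_compl_singleton.mem_nhds hqp : ({q}ᶜ : Set _) ∈ 𝓝 (b T.pt))
      have h2 : (b ∘ T.ι) ⁻¹' N ∈ T.trace := hjt hN
      rw [hTG] at h2
      obtain ⟨S₁, hS₁, S₂, hS₂, hSS⟩ := mem_inf_iff.1 h2
      obtain ⟨K, hK, hKS⟩ := mem_cocompact.1 hS₁
      obtain ⟨m, -, hm⟩ := hB.1.mem_iff.1 hS₂
      have hKc : IsClosed ((b ∘ T.ι) '' K) := (hK.image hj.continuous).isClosed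
      have hU : IsOpen (M m ∩ Nᶜ ∩ ((b ∘ T.ι) '' K)ᶜ) :=
        ((hM m).inter hNc.isOpen_compl).inter hKc.isOpen_compl
      obtain ⟨x, ⟨hx1, hx2⟩, hx3⟩ := hjd.exists_mem_open hU
        ⟨q, ⟨hqM m, fun h => hNq h rfl⟩, fun h => hqj (image_subset_range _ _ h)⟩
      apply hx2
      change x ∈ (b ∘ T.ι) ⁻¹' N
      rw [hSS]
      exact ⟨hKS fun h => hx3 ⟨x, h, rfl⟩, hm (hMB m hx1)⟩

end Cech

section Assemble

theorem exists_small [T35Space X]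
    {P : (Z : Type u) → [TopologicalSpace Z] → Prop} (hProp : TopProperty P)
    (hP : IsPseudocompactness P ∨ (ClosedHereditary P ∧ MrowkaW P ∧ FiniteClosedSums P))
    (hloc : LocallyP P X) (hn : ¬ P X) :
    ∃ Q : Set X → Prop, SmallSets X Q ∧ ∀ T : OnePointExt X, P T.carrier ↔ T.trace ∈ FE Q := by
  rcases hP with hP | ⟨hC, hW, hF⟩
  · refine ⟨BddSet, smallSets_pseudo fun h => hn ((hP X).2 h), fun T => ?_⟩
    rw [hP]
    exact mem_FE_pseudo T
  · exact ⟨fun A => P A, smallSets_mrowka hProp hC hF hloc hn,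
      fun T => mem_FE_mrowka hProp hC hW T⟩

/-- Translation: from maps of extensions to maps of filters. -/
theorem toFilters {X Y : Type u} [TopologicalSpace X] [TopologicalSpace Y]
    {A : Set (OnePointExt X)} {B : Set (OnePointExt Y)} {E : Set (Filter X)} {E' : Set (Filter Y)}
    (hA : ∀ T, T ∈ A ↔ T.trace ∈ E) (hB : ∀ T, T ∈ B ↔ T.trace ∈ E')
    (hE : ∀ F ∈ E, ∃ T : OnePointExt X, T.trace = F)
    (hE' : ∀ F ∈ E', ∃ T : OnePointExt Y, T.trace = F)
    {Δ : OnePointExt X → OnePointExt Y} (h : RestrictedOrderIso A B Δ) :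
    ∃ φ : Filter X → Filter Y, OIso E E' φ ∧ ∀ T ∈ A, (Δ T).trace = φ T.trace := by
  classical
  obtain ⟨h1, h2, h3⟩ := h
  choose r hr using hE
  let φ : Filter X → Filter Y := fun F => if hF : F ∈ E then (Δ (r F hF)).trace else ⊥
  have hrA : ∀ F (hF : F ∈ E), r F hF ∈ A := fun F hF => by
    rw [hA, hr]
    exact hF
  have hφ : ∀ F (hF : F ∈ E), φ F = (Δ (r F hF)).trace := fun F hF => dif_pos hF
  have hmon : ∀ T₁ ∈ A, ∀ T₂ ∈ A, (T₁.trace ≤ T₂.trace ↔ (Δ T₁).trace ≤ (Δ T₂).trace) := by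
    intro T₁ hT₁ T₂ hT₂
    rw [← OnePointExt.le_iff_s15, ← OnePointExt.le_iff_s15]
    exact h2 T₂ hT₂ T₁ hT₁
  have hφT : ∀ T ∈ A, (Δ T).trace = φ T.trace := by
    intro T hT
    have hTE := (hA T).1 hT
    rw [hφ _ hTE]
    have e := hr _ hTE
    exact le_antisymm ((hmon _ hT _ (hrA _ hTE)).1 e.ge) ((hmon _ (hrA _ hTE) _ hT).1 e.le)
  refine ⟨φ, ⟨?_, ?_, ?_⟩, hφT⟩
  · intro F hF
    rw [hφ F hF, ← hB]
    exact h1 _ (hrA F hF)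
  · intro F hF G hG
    rw [hφ F hF, hφ G hG, ← hmon _ (hrA F hF) _ (hrA G hG), hr, hr]
  · intro G hG
    obtain ⟨S, rfl⟩ := hE' G hG
    obtain ⟨T, hT, hTS⟩ := h3 S ((hB S).2 hG)
    rw [OnePointExt.equiv_iff] at hTS
    exact ⟨T.trace, (hA T).1 hT, by rw [← hφT T hT, hTS]⟩

/-- Translation: from maps of filters back to maps of extensions. -/
theorem ofFilters {X Y : Type u} [TopologicalSpace X] [TopologicalSpace Y]
    {A : Set (OnePointExt X)} {B : Set (OnePointExt Y)} {E : Set (Filter X)} {E' : Set (Filter Y)}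
    (hA : ∀ T, T ∈ A ↔ T.trace ∈ E) (hB : ∀ T, T ∈ B ↔ T.trace ∈ E')
    (hE : ∀ F ∈ E, ∃ T : OnePointExt X, T.trace = F)
    {Δ : OnePointExt X → OnePointExt Y} {φ : Filter X → Filter Y} (h : OIso E E' φ)
    (hφ : ∀ T ∈ A, (Δ T).trace = φ T.trace) : RestrictedOrderIso A B Δ := by
  refine ⟨?_, ?_, ?_⟩
  · intro T hT
    rw [hB, hφ T hT]
    exact h.1 _ ((hA T).1 hT)
  · intro T₁ h₁ T₂ h₂
    rw [OnePointExt.le_iff_s15, OnePointExt.le_iff_s15, hφ _ h₁, hφ _ h₂]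
    exact h.2.1 _ ((hA _).1 h₂) _ ((hA _).1 h₁)
  · intro S hS
    obtain ⟨F, hF, hFS⟩ := h.2.2 _ ((hB S).1 hS)
    obtain ⟨T, rfl⟩ := hE F hF
    refine ⟨T, (hA T).2 hF, ?_⟩
    rw [OnePointExt.equiv_iff, hφ T ((hA T).2 hF), hFS]

end Assemble

/-- Let `X` and `Y` be locally compact, locally-P Tychonoff spaces not
having `P`, where `P` is either pseudocompactness or a closed hereditary Mrówka topological
property preserved under finite closed sums of subspaces.  Every order-isomorphism from
`(E_P(X), ≤)` onto `(E_P(Y), ≤)` restricts to an order-isomorphism from `(E^C_P(X), ≤)` onto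
`(E^C_P(Y), ≤)`; conversely, every order-isomorphism from `(E^C_P(X), ≤)` onto
`(E^C_P(Y), ≤)` extends to an order-isomorphism from `(E_P(X), ≤)` onto `(E_P(Y), ≤)`. -/
theorem stmt15 {X Y : Type u} [TopologicalSpace X] [T35Space X] [LocallyCompactSpace X]
    [TopologicalSpace Y] [T35Space Y] [LocallyCompactSpace Y]
    (P : (Z : Type u) → [TopologicalSpace Z] → Prop) (hProp : TopProperty P)
    (hP : IsPseudocompactness P ∨ (ClosedHereditary P ∧ MrowkaW P ∧ FiniteClosedSums P))
    (hlocX : LocallyP P X) (hlocY : LocallyP P Y) (hnX : ¬ P X) (hnY : ¬ P Y) :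
    (∀ Δ : OnePointExt X → OnePointExt Y,
      RestrictedOrderIso {T : OnePointExt X | P T.carrier}
        {S : OnePointExt Y | P S.carrier} Δ →
      RestrictedOrderIso {T : OnePointExt X | P T.carrier ∧ CechComplete T.carrier}
        {S : OnePointExt Y | P S.carrier ∧ CechComplete S.carrier} Δ) ∧
    (∀ δ : OnePointExt X → OnePointExt Y,
      RestrictedOrderIso {T : OnePointExt X | P T.carrier ∧ CechComplete T.carrier}
        {S : OnePointExt Y | P S.carrier ∧ CechComplete S.carrier} δ →
      ∃ Δ : OnePointExt X → OnePointExt Y,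
        RestrictedOrderIso {T : OnePointExt X | P T.carrier}
          {S : OnePointExt Y | P S.carrier} Δ ∧
        ∀ T : OnePointExt X, P T.carrier → CechComplete T.carrier →
          (Δ T).equiv (δ T)) := by
  obtain ⟨Q, hQ, hQP⟩ := exists_small hProp hP hlocX hnX
  obtain ⟨Q', hQ', hQP'⟩ := exists_small hProp hP hlocY hnY
  have hX := FE.sys hQ
  have hY := FE.sys hQ'
  have rX : ∀ F ∈ FE Q, ∃ T : OnePointExt X, T.trace = F :=
    fun F hF => OnePointExt.exists_trace hF.1
  have rY : ∀ F ∈ FE Q', ∃ T : OnePointExt Y, T.trace = F :=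
    fun F hF => OnePointExt.exists_trace hF.1
  have cX : ∀ T : OnePointExt X, (P T.carrier ∧ CechComplete T.carrier) ↔
      (T.trace ∈ FE Q ∧ CechF T.trace) := fun T => and_congr (hQP T) (cech_iff T)
  have cY : ∀ T : OnePointExt Y, (P T.carrier ∧ CechComplete T.carrier) ↔
      (T.trace ∈ FE Q' ∧ CechF T.trace) := fun T => and_congr (hQP' T) (cech_iff T)
  constructor
  · intro Δ hΔ
    obtain ⟨φ, hφ, hΔφ⟩ := toFilters hQP hQP' rX rY hΔ
    exact ofFilters cX cY (fun F hF => rX F hF.1) (hφ.restrict hX hY)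
      (fun T hT => hΔφ T hT.1)
  · intro δ hδ
    obtain ⟨φ, hφ, hδφ⟩ := toFilters (E := {F | F ∈ FE Q ∧ CechF F})
      (E' := {F | F ∈ FE Q' ∧ CechF F}) cX cY (fun F hF => rX F hF.1) (fun F hF => rY F hF.1) hδ
    obtain ⟨ψ, hψ, hψφ⟩ := hφ.extend hX hY
    have hex : ∀ T : OnePointExt X, ∃ S : OnePointExt Y, P T.carrier → S.trace = ψ T.trace := by
      intro T
      by_cases hT : P T.carrier
      · obtain ⟨S, hS⟩ := rY _ (hψ.1 _ ((hQP T).1 hT))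
        exact ⟨S, fun _ => hS⟩
      · exact ⟨δ T, fun h => absurd h hT⟩
    choose Δ hΔ using hex
    refine ⟨Δ, ofFilters hQP hQP' rX hψ hΔ, fun T hT hTc => ?_⟩
    rw [OnePointExt.equiv_iff, hΔ T hT, hδφ T ⟨hT, hTc⟩, hψφ _ ((cX T).1 ⟨hT, hTc⟩)]
end

section
/- Let X and Y be locally compact, locally-P Tychonoff spaces not having P, where P is either pseudocompactness or a closed hereditary Mrówka topological property preserved under finite closed sums of subspaces. Then every order-isomorphism from (E^C_P(X), ≤) onto (E^C_P(Y), ≤) restricts to an order-isomorphism from (E^K_P(X), ≤) onto (E^K_P(Y), ≤). Conversely, if X and Y are moreover strongly zero-dimensional, then every order-isomorphism from (E^K_P(X), ≤) onto (E^K_P(Y), ≤) extends to an order-isomorphism from (E^C_P(X), ≤) onto (E^C_P(Y), ≤). -/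
open Set Topology Filter

universe u

variable {X : Type u} [TopologicalSpace X]

namespace Stmt16

theorem isOpen_range_unit {Z : Type u} [TopologicalSpace Z] [T35Space Z]
    [LocallyCompactSpace Z] : IsOpen (range (stoneCechUnit : Z → StoneCech Z)) := by
  rw [isOpen_iff_mem_nhds]
  rintro _ ⟨x, rfl⟩
  obtain ⟨C, hC, hxC⟩ := exists_compact_mem_nhds x
  obtain ⟨V, hVC, hV, hxV⟩ := mem_nhds_iff.1 hxC
  obtain ⟨W, hW, rfl⟩ := isInducing_stoneCechUnit.isOpen_iff.1 hV
  refine mem_nhds_iff.2 ⟨W, ?_, hW, hxV⟩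
  have h1 : W ⊆ closure (stoneCechUnit '' (stoneCechUnit ⁻¹' W : Set Z)) := by
    rw [image_preimage_eq_inter_range]
    exact (denseRange_stoneCechUnit (α := Z)).open_subset_closure_inter hW
  refine h1.trans ?_
  refine (closure_mono (image_mono hVC)).trans ?_
  rw [(hC.image continuous_stoneCechUnit).isClosed.closure_eq]
  exact image_subset_range _ _

section Ext

variable (T : OnePointExt X)

theorem tau_cont : Continuous T.tau := continuous_stoneCechExtend _

theorem tau_unit (x : X) : T.tau (stoneCechUnit x) = stoneCechUnit (T.ι x) :=
  stoneCechExtend_stoneCechUnit _ x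

theorem iota_ne (x : X) : T.ι x ≠ T.pt := by
  have : T.ι x ∈ range T.ι := ⟨x, rfl⟩
  rw [T.range_eq] at this
  exact this

theorem cases_pt (t : T.carrier) : t = T.pt ∨ ∃ x, t = T.ι x := by
  by_cases h : t = T.pt
  · exact Or.inl h
  · have : t ∈ range T.ι := by rw [T.range_eq]; exact h
    obtain ⟨x, rfl⟩ := this
    exact Or.inr ⟨x, rfl⟩

theorem iota_open : IsOpenEmbedding T.ι :=
  ⟨T.emb, by rw [T.range_eq]; exact isOpen_compl_singleton⟩

theorem tau_surj : Function.Surjective T.tau := by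
  have h1 : DenseRange T.tau := by
    have h2 : DenseRange ((stoneCechUnit : T.carrier → _) ∘ T.ι) :=
      denseRange_stoneCechUnit.comp T.dense continuous_stoneCechUnit
    refine h2.mono ?_
    rintro _ ⟨x, rfl⟩
    exact ⟨stoneCechUnit x, tau_unit T x⟩
  have h3 : IsClosed (range T.tau) := (isCompact_range (tau_cont T)).isClosed
  rw [← range_eq_univ, ← h3.closure_eq]
  exact h1.closure_range

theorem theta_closed : IsClosed T.theta := isClosed_singleton.preimage (tau_cont T)

theorem theta_nonempty : T.theta.Nonempty := by
  obtain ⟨q, hq⟩ := tau_surj T (stoneCechUnit T.pt)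
  exact ⟨q, hq⟩

theorem unit_notMem_theta (x : X) : stoneCechUnit x ∉ T.theta := by
  intro h
  have h1 : T.tau (stoneCechUnit x) = stoneCechUnit T.pt := h
  rw [tau_unit] at h1
  exact iota_ne T x (injective_stoneCechUnit_of_t35Space h1)

theorem comap_iota : comap T.ι (𝓝 T.pt) = comap stoneCechUnit (𝓝ˢ T.theta) := by
  have h1 : IsClosedMap T.tau := (tau_cont T).isClosedMap
  rw [isInducing_stoneCechUnit.nhds_eq_comap, comap_comap, OnePointExt.theta,
    ← h1.comap_nhds_eq (tau_cont T), comap_comap]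
  congr 1
  funext x
  exact (tau_unit T x).symm

theorem comap_unit_neBot (q : StoneCech X) :
    (comap (stoneCechUnit : X → StoneCech X) (𝓝 q)).NeBot := by
  refine comap_neBot fun t ht => ?_
  obtain ⟨_, h1, x, rfl⟩ := mem_closure_iff_nhds.1 (denseRange_stoneCechUnit q) t ht
  exact ⟨x, h1⟩

theorem tendsto_tau (q : StoneCech X) :
    Tendsto (fun x => (stoneCechUnit (T.ι x))) (comap stoneCechUnit (𝓝 q)) (𝓝 (T.tau q)) := by
  have := ((tau_cont T).tendsto q).comp (tendsto_comap (f := (stoneCechUnit : X → _)))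
  refine this.congr fun x => tau_unit T x

theorem tau_eq_iff (q : StoneCech X) (t : T.carrier) :
    T.tau q = stoneCechUnit t ↔ Tendsto T.ι (comap stoneCechUnit (𝓝 q)) (𝓝 t) := by
  have := comap_unit_neBot q
  rw [isInducing_stoneCechUnit.tendsto_nhds_iff]
  constructor
  · intro h
    rw [← h]
    exact tendsto_tau T q
  · intro h
    exact tendsto_nhds_unique (tendsto_tau T q) h

theorem mem_theta_iff (q : StoneCech X) :
    q ∈ T.theta ↔ Tendsto T.ι (comap stoneCechUnit (𝓝 q)) (𝓝 T.pt) :=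
  tau_eq_iff T q T.pt

theorem tau_eq_unit [T35Space X] (q : StoneCech X) (x : X)
    (h : T.tau q = stoneCechUnit (T.ι x)) : q = stoneCechUnit x := by
  have := comap_unit_neBot q
  rw [tau_eq_iff] at h
  have h1 : Tendsto (id : X → X) (comap stoneCechUnit (𝓝 q)) (𝓝 x) :=
    T.emb.isInducing.tendsto_nhds_iff.2 h
  have h2 : Tendsto (stoneCechUnit : X → _) (comap stoneCechUnit (𝓝 q))
      (𝓝 (stoneCechUnit x)) := (continuous_stoneCechUnit.tendsto x).comp h1
  exact tendsto_nhds_unique tendsto_comap h2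

theorem extend_cont {Z : Type*} [TopologicalSpace Z] {g : X → Z} (hg : Continuous g) {c : Z}
    (h : Tendsto g (comap stoneCechUnit (𝓝ˢ T.theta)) (𝓝 c)) :
    ∃ f : T.carrier → Z, Continuous f ∧ (∀ x, f (T.ι x) = g x) ∧ f T.pt = c := by
  have h1 : ∀ x, Function.extend T.ι g (fun _ => c) (T.ι x) = g x :=
    fun x => T.emb.injective.extend_apply _ _ _
  have h2 : Function.extend T.ι g (fun _ => c) T.pt = c :=
    Function.extend_apply' _ _ _ (by rintro ⟨x, hx⟩; exact iota_ne T x hx)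
  refine ⟨Function.extend T.ι g (fun _ => c), ?_, h1, h2⟩
  rw [continuous_iff_continuousAt]
  intro t
  rcases cases_pt T t with rfl | ⟨x, rfl⟩
  · rw [ContinuousAt, h2, tendsto_def]
    intro s hs
    rw [← comap_iota] at h
    obtain ⟨v, hv, hvs⟩ := mem_comap.1 (h hs)
    filter_upwards [hv] with t ht
    rcases cases_pt T t with rfl | ⟨x, rfl⟩
    · rw [mem_preimage, h2]; exact mem_of_mem_nhds hs
    · rw [mem_preimage, h1]; exact hvs ht
  · rw [← (iota_open T).continuousAt_iff]
    have : Function.extend T.ι g (fun _ => c) ∘ T.ι = g := funext h1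
    rw [this]
    exact hg.continuousAt

theorem le_iff [T35Space X] (T1 T2 : OnePointExt X) : T1.le T2 ↔ T2.theta ⊆ T1.theta := by
  constructor
  · rintro ⟨f, hf, hfx⟩ q hq
    have h1 := (hf.tendsto _).comp ((mem_theta_iff T2 q).1 hq)
    have h2 : Tendsto T1.ι (comap stoneCechUnit (𝓝 q)) (𝓝 (f T2.pt)) :=
      h1.congr hfx
    rcases cases_pt T1 (f T2.pt) with h | ⟨x, h⟩
    · rw [h] at h2
      exact (mem_theta_iff T1 q).2 h2
    · rw [h] at h2
      have := tau_eq_unit T1 q x ((tau_eq_iff T1 _ _).2 h2)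
      rw [this] at hq
      exact absurd hq (unit_notMem_theta T2 x)
  · intro h
    obtain ⟨f, hf, hfx, -⟩ := extend_cont T2 T1.emb.continuous (c := T1.pt) (by
      rw [tendsto_iff_comap, comap_iota]
      exact comap_mono (nhdsSet_mono h))
    exact ⟨f, hf, hfx⟩

theorem equiv_of_eq [T35Space X] (T1 T2 : OnePointExt X) (h : T1.theta = T2.theta) :
    T1.equiv T2 := by
  obtain ⟨f, hf, hfx⟩ := (le_iff T1 T2).2 h.ge
  obtain ⟨g, hg, hgx⟩ := (le_iff T2 T1).2 h.le
  refine ⟨⟨⟨g, f, ?_, ?_⟩, hg, hf⟩, hgx⟩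
  · refine congrFun (T1.dense.equalizer (hf.comp hg) continuous_id ?_)
    funext x
    simp [hfx, hgx]
  · refine congrFun (T2.dense.equalizer (hg.comp hf) continuous_id ?_)
    funext x
    simp [hfx, hgx]

theorem le_of_equiv (T1 T2 : OnePointExt X) (h : T1.equiv T2) : T1.le T2 ∧ T2.le T1 := by
  obtain ⟨e, he⟩ := h
  exact ⟨⟨e.symm, e.symm.continuous, fun x => by simp [← he]⟩, ⟨e, e.continuous, he⟩⟩

theorem eq_of_equiv [T35Space X] (T1 T2 : OnePointExt X) (h : T1.equiv T2) :
    T1.theta = T2.theta := by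
  obtain ⟨h1, h2⟩ := le_of_equiv T1 T2 h
  exact ((le_iff _ _).1 h2).antisymm ((le_iff _ _).1 h1)

theorem preimage_range : T.tau ⁻¹' range stoneCechUnit ⊇ range stoneCechUnit ∪ T.theta := by
  rintro q (⟨x, rfl⟩ | hq)
  · exact ⟨_, (tau_unit T x).symm⟩
  · exact ⟨_, Eq.symm hq⟩

theorem preimage_range_eq [T35Space X] :
    T.tau ⁻¹' range stoneCechUnit = range stoneCechUnit ∪ T.theta := by
  refine Subset.antisymm ?_ (preimage_range T)
  rintro q ⟨t, ht⟩
  rcases cases_pt T t with rfl | ⟨x, rfl⟩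
  · exact Or.inr ht.symm
  · exact Or.inl ⟨x, (tau_eq_unit T q x ht.symm).symm⟩

theorem image_compl [T35Space X] :
    T.tau '' (range stoneCechUnit ∪ T.theta)ᶜ = (range stoneCechUnit)ᶜ := by
  rw [← preimage_range_eq, ← preimage_compl, image_preimage_eq _ (tau_surj T)]

theorem lc_iff [T35Space X] :
    LocallyCompactSpace T.carrier ↔ IsOpen (range stoneCechUnit ∪ T.theta) := by
  constructor
  · intro h
    rw [← preimage_range_eq]
    exact isOpen_range_unit.preimage (tau_cont T)
  · intro h
    have h1 : IsClosed (range (stoneCechUnit : T.carrier → _))ᶜ := by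
      rw [← image_compl]
      exact (tau_cont T).isClosedMap _ h.isClosed_compl
    have h2 : IsOpenEmbedding (stoneCechUnit : T.carrier → _) :=
      ⟨isEmbedding_stoneCechUnit, isClosed_compl_iff.1 h1⟩
    exact h2.locallyCompactSpace

theorem cech_iff [T35Space X] :
    CechComplete T.carrier ↔ IsGδ (range stoneCechUnit ∪ T.theta) := by
  constructor
  · intro h
    rw [← preimage_range_eq]
    exact h.preimage (tau_cont T)
  · intro h
    obtain ⟨O, hO, hOe⟩ := h.eq_iInter_nat
    have h1 : range (stoneCechUnit : T.carrier → _) = ⋂ n, (T.tau '' (O n)ᶜ)ᶜ := by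
      rw [← compl_inj_iff, ← image_compl, hOe, compl_iInter, compl_iInter, image_iUnion]
      simp
    rw [CechComplete, h1]
    exact IsGδ.iInter fun n =>
      ((tau_cont T).isClosedMap _ (hO n).isClosed_compl).isOpen_compl.isGδ

/-- The remainder of `X` in its Stone-Cech compactification. -/
abbrev Rem (X : Type u) [TopologicalSpace X] : Type u :=
  {q : StoneCech X // q ∉ range (stoneCechUnit : X → StoneCech X)}

/-- The trace of `theta` in the remainder. -/
def S (T : OnePointExt X) : Set (Rem X) := Subtype.val ⁻¹' T.theta

theorem image_S : Subtype.val '' (S T) = T.theta := by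
  rw [S, image_preimage_eq_inter_range, inter_eq_left]
  intro q hq
  refine ⟨⟨q, ?_⟩, rfl⟩
  rintro ⟨x, rfl⟩
  exact unit_notMem_theta T x hq

theorem S_subset (T1 T2 : OnePointExt X) : S T1 ⊆ S T2 ↔ T1.theta ⊆ T2.theta := by
  constructor
  · intro h
    rw [← image_S T1, ← image_S T2]
    exact image_mono h
  · exact fun h => preimage_mono h

theorem rem_closed [T35Space X] [LocallyCompactSpace X] :
    IsClosedEmbedding (Subtype.val : Rem X → StoneCech X) :=
  isOpen_range_unit.isClosed_compl.isClosedEmbedding_subtypeVal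

theorem S_union_compl : (range stoneCechUnit ∪ T.theta)ᶜ = Subtype.val '' (S T)ᶜ := by
  ext q
  simp [S, and_comm]

theorem S_open [T35Space X] [LocallyCompactSpace X] :
    IsOpen (range stoneCechUnit ∪ T.theta) ↔ IsOpen (S T) := by
  rw [← isClosed_compl_iff, S_union_compl, ← isClosed_compl_iff,
    rem_closed.isClosed_iff_image_isClosed]

theorem S_gdelta [T35Space X] [LocallyCompactSpace X] :
    IsGδ (range stoneCechUnit ∪ T.theta) ↔ IsGδ (S T) := by
  constructor
  · intro h
    have : S T = Subtype.val ⁻¹' (range stoneCechUnit ∪ T.theta) := by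
      ext q
      have := q.2
      simp only [S, mem_preimage, mem_union]
      tauto
    rw [this]
    exact h.preimage continuous_subtype_val
  · intro h
    obtain ⟨O, hO, hOe⟩ := h.eq_iInter_nat
    have h1 : range (stoneCechUnit : X → _) ∪ T.theta
        = ⋂ n, (Subtype.val '' (O n)ᶜ)ᶜ := by
      rw [← compl_inj_iff, S_union_compl, hOe, compl_iInter, compl_iInter, image_iUnion]
      simp
    rw [h1]
    exact IsGδ.iInter fun n =>
      (rem_closed.isClosedMap _ (hO n).isClosed_compl).isOpen_compl.isGδ

end Ext

section Realize

open unitInterval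

theorem urysohn {Z : Type*} [TopologicalSpace Z] [T35Space Z] (q : Z) (C : Set Z)
    (hC : IsClosed C) (hq : q ∉ C) : ∃ f : Z → I, Continuous f ∧ f q = 0 ∧ EqOn f 1 C :=
  CompletelyRegularSpace.completely_regular q C hC hq

theorem realize [T35Space X] (C : Set (StoneCech X)) (hC : IsClosed C)
    (hne : C.Nonempty) (hX : ∀ x, stoneCechUnit x ∉ C) : ∃ T : OnePointExt X, T.theta = C := by
  obtain ⟨c, hc⟩ := hne
  let A := {g : StoneCech X → I // Continuous g ∧ ∀ q ∈ C, g q = g c}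
  let F : StoneCech X → (A → I) := fun q g => g.1 q
  have hF : Continuous F := continuous_pi fun g => g.2.1
  have hFC : ∀ q, F q = F c ↔ q ∈ C := by
    intro q
    constructor
    · intro h
      by_contra hq
      obtain ⟨f, hf, hfq, hf1⟩ := urysohn q C hC hq
      have := congrFun h ⟨f, hf, fun r hr => by rw [hf1 hr, hf1 hc]; rfl⟩
      have h1 : f q = f c := this
      rw [hfq, hf1 hc] at h1
      exact zero_ne_one h1
    · intro h
      funext g
      exact g.2.2 q h
  let Φ : Option X → (A → I) := fun o => o.elim (F c) (fun x => F (stoneCechUnit x))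
  let top : TopologicalSpace (Option X) := TopologicalSpace.induced Φ inferInstance
  have hind : IsInducing Φ := ⟨rfl⟩
  have hsep : ∀ (x : X) (N : Set (StoneCech X)), IsOpen N → stoneCechUnit x ∈ N →
      ∃ g : A, g.1 (stoneCechUnit x) = 0 ∧ (∀ q ∈ Nᶜ, g.1 q = 1) ∧ g.1 c = 1 := by
    intro x N hN hxN
    obtain ⟨f, hf, hfq, hf1⟩ := urysohn (stoneCechUnit x) (C ∪ Nᶜ) (hC.union hN.isClosed_compl)
      (by rintro (h | h); exacts [hX x h, h hxN])
    exact ⟨⟨f, hf, fun r hr => by rw [hf1 (Or.inl hr), hf1 (Or.inl hc)]; rfl⟩, hfq,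
      fun q hq => hf1 (Or.inr hq), hf1 (Or.inl hc)⟩
  have hemb0 : IsInducing (fun x : X => F (stoneCechUnit x)) := by
    rw [isInducing_iff_nhds]
    intro x
    apply le_antisymm
    · exact ((hF.comp continuous_stoneCechUnit).tendsto x).le_comap
    · intro U hU
      rw [isInducing_stoneCechUnit.nhds_eq_comap] at hU
      obtain ⟨N', hN', hNU⟩ := mem_comap.1 hU
      obtain ⟨N, hNN, hN, hxN⟩ := mem_nhds_iff.1 hN'
      obtain ⟨g, hg0, hg1, -⟩ := hsep x N hN hxN
      refine mem_comap.2 ⟨(fun φ : A → I => φ g) ⁻¹' {1}ᶜ, ?_, ?_⟩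
      · refine (continuous_apply g).continuousAt.preimage_mem_nhds
          (isOpen_compl_singleton.mem_nhds ?_)
        change g.1 (stoneCechUnit x) ≠ 1
        rw [hg0]
        exact zero_ne_one
      · intro y hy
        apply hNU
        apply hNN
        by_contra hyN
        exact hy (hg1 _ hyN)
  have hinj : Function.Injective Φ := by
    have hi : Function.Injective (fun x : X => F (stoneCechUnit x)) := hemb0.injective
    rintro (_ | x) (_ | y) h
    · rfl
    · exact absurd ((hFC _).1 (Eq.symm h)) (hX y)
    · exact absurd ((hFC _).1 h) (hX x)
    · exact congrArg some (hi h)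
  have hΦ : IsEmbedding Φ := ⟨hind, hinj⟩
  have hιind : IsInducing (some : X → Option X) := by
    have : IsInducing (Φ ∘ some) := hemb0
    exact (hind.of_comp_iff).1 this
  have hkey : ∀ q ∈ C, Tendsto (some : X → Option X) (comap stoneCechUnit (𝓝 q)) (𝓝 none) := by
    intro q hq
    rw [hind.tendsto_nhds_iff]
    have h1 : Φ none = F q := ((hFC q).2 hq).symm
    rw [h1]
    exact (hF.tendsto q).comp tendsto_comap
  let T : OnePointExt X :=
    { carrier := Option X
      top := top
      t35 := hΦ.t35Space
      ι := some
      emb := ⟨hιind, Option.some_injective X⟩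
      pt := none
      range_eq := by
        ext o
        cases o <;> simp
      dense := by
        rintro (_ | x)
        · have := comap_unit_neBot c
          exact mem_closure_of_tendsto (hkey c hc) (Eventually.of_forall fun x => ⟨x, rfl⟩)
        · exact subset_closure ⟨x, rfl⟩ }
  refine ⟨T, ?_⟩
  ext q
  rw [mem_theta_iff]
  constructor
  · intro h
    have h1 : Tendsto (Φ ∘ some) (comap stoneCechUnit (𝓝 q)) (𝓝 (Φ none)) :=
      hind.tendsto_nhds_iff.1 h
    have h2 : Tendsto (Φ ∘ some) (comap stoneCechUnit (𝓝 q)) (𝓝 (F q)) :=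
      (hF.tendsto q).comp tendsto_comap
    have := comap_unit_neBot q
    exact (hFC q).1 (tendsto_nhds_unique h2 h1)
  · exact hkey q

end Realize

section Pseudo

open unitInterval

/-- Pseudocompactness in terms of zero-sets of the Stone-Cech compactification. -/
theorem pseudo_iff (Z : Type u) [TopologicalSpace Z] :
    Pseudocompact Z ↔ ∀ h : StoneCech Z → I, Continuous h →
      (∀ z, h (stoneCechUnit z) ≠ 0) → ∀ y, h y ≠ 0 := by
  constructor
  · intro hZ h hc hpos y hy
    have hpos' : ∀ z, 0 < (h (stoneCechUnit z) : ℝ) := fun z =>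
      lt_of_le_of_ne (h _).2.1 fun e => hpos z (Subtype.ext e.symm)
    obtain ⟨M, hM⟩ := hZ (fun z => ((h (stoneCechUnit z) : ℝ))⁻¹)
      (Continuous.inv₀ (by have := continuous_stoneCechUnit (α := Z); fun_prop)
        fun z => (hpos' z).ne')
    have h1 : ∀ y, 1 ≤ max M 1 * (h y : ℝ) := by
      intro y
      have hcl : IsClosed {y | 1 ≤ max M 1 * (h y : ℝ)} :=
        isClosed_le continuous_const (by fun_prop)
      refine hcl.closure_subset_iff.2 ?_ (denseRange_stoneCechUnit y)
      rintro _ ⟨z, rfl⟩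
      have h2 := (le_abs_self _).trans (hM z)
      have h3 := h2.trans (le_max_left M 1)
      rw [mem_ofPred_eq]
      calc (1 : ℝ) = (h (stoneCechUnit z) : ℝ)⁻¹ * h (stoneCechUnit z) :=
            (inv_mul_cancel₀ (hpos' z).ne').symm
        _ ≤ _ := mul_le_mul_of_nonneg_right h3 (hpos' z).le
    have := h1 y
    rw [hy] at this
    norm_num at this
  · intro H f hf
    by_contra hM
    push Not at hM
    have hpos : ∀ z, 0 < 1 + |f z| := fun z => by positivity
    let g : Z → I := fun z => ⟨(1 + |f z|)⁻¹, inv_nonneg.2 (hpos z).le,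
      inv_le_one_of_one_le₀ (by linarith [abs_nonneg (f z)])⟩
    have hg : Continuous g := by
      refine Continuous.subtype_mk (Continuous.inv₀ (by fun_prop) fun z => (hpos z).ne') _
    have h0 := H (stoneCechExtend hg) (continuous_stoneCechExtend hg) (by
      intro z hz
      rw [stoneCechExtend_stoneCechUnit] at hz
      exact (inv_pos.2 (hpos z)).ne' (congrArg Subtype.val hz))
    obtain ⟨z0, -⟩ := hM 0
    have : Nonempty (StoneCech Z) := ⟨stoneCechUnit z0⟩
    obtain ⟨m, -, hm⟩ := isCompact_univ.exists_isMinOn (univ_nonempty (α := StoneCech Z))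
      (f := fun y => ((stoneCechExtend hg y : I) : ℝ))
      (continuous_subtype_val.comp (continuous_stoneCechExtend hg)).continuousOn
    have hmpos : 0 < ((stoneCechExtend hg m : I) : ℝ) :=
      lt_of_le_of_ne (stoneCechExtend hg m).2.1 fun e => h0 m (Subtype.ext e.symm)
    obtain ⟨z, hz⟩ := hM ((stoneCechExtend hg m : I) : ℝ)⁻¹
    have h1 : ((stoneCechExtend hg m : I) : ℝ) ≤ ((stoneCechExtend hg (stoneCechUnit z) : I) : ℝ) :=
      hm (mem_univ _)
    rw [stoneCechExtend_stoneCechUnit] at h1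
    have h2 : ((stoneCechExtend hg m : I) : ℝ) ≤ (1 + |f z|)⁻¹ := h1
    have h3 := (le_inv_comm₀ hmpos (hpos z)).1 h2
    have h4 : ((stoneCechExtend hg m : I) : ℝ)⁻¹ < 1 + |f z| := by linarith
    linarith

end Pseudo
section PropertyP

open unitInterval

theorem pseudo_core [T35Space X] (hn : ¬ Pseudocompact X) :
    ∃ C0 : Set (StoneCech X), C0.Nonempty ∧ (∀ x, stoneCechUnit x ∉ C0) ∧
      ∀ T : OnePointExt X, Pseudocompact T.carrier ↔ C0 ⊆ T.theta := by
  refine ⟨{q | ∃ h : StoneCech X → I, Continuous h ∧ (∀ x, h (stoneCechUnit x) ≠ 0) ∧ h q = 0},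
    ?_, ?_, ?_⟩
  · rw [pseudo_iff] at hn
    push Not at hn
    obtain ⟨h, hc, hx, q, hq⟩ := hn
    exact ⟨q, h, hc, hx, hq⟩
  · rintro x ⟨h, -, hx, h0⟩
    exact hx x h0
  · intro T
    rw [pseudo_iff]
    constructor
    · rintro H q ⟨h, hc, hx, hq⟩
      by_contra hqT
      obtain ⟨k, hk, hkq, hk1⟩ := urysohn q T.theta (theta_closed T) hqT
      have hmc : Continuous fun y => max (h y) (k y) := hc.max hk
      have hmT : ∀ y ∈ T.theta, max (h y) (k y) = 1 := by
        intro y hy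
        rw [hk1 hy]
        exact max_eq_right (h y).2.2
      obtain ⟨f, hf, hfx, hfp⟩ := extend_cont T (hmc.comp continuous_stoneCechUnit) (c := 1) (by
        have h1 : Tendsto (fun y => max (h y) (k y)) (𝓝ˢ T.theta) (𝓝 1) := by
          intro s hs
          rw [mem_map, mem_nhdsSet_iff_forall]
          intro y hy
          have := hmc.tendsto y
          simp only [hmT y hy] at this
          exact this hs
        exact h1.comp tendsto_comap)
      have h2 : ∀ y, stoneCechExtend hf (T.tau y) = max (h y) (k y) := by
        refine congrFun (denseRange_stoneCechUnit.equalizer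
          ((continuous_stoneCechExtend hf).comp (tau_cont T)) hmc ?_)
        funext x
        simp only [Function.comp, tau_unit, stoneCechExtend_stoneCechUnit, hfx]
      refine H (stoneCechExtend hf) (continuous_stoneCechExtend hf) ?_ (T.tau q) ?_
      · intro t
        rw [stoneCechExtend_stoneCechUnit]
        rcases cases_pt T t with rfl | ⟨x, rfl⟩
        · rw [hfp]; exact one_ne_zero
        · rw [hfx]
          intro h0
          have h3 : h (stoneCechUnit x) ≤ 0 := h0 ▸ le_max_left _ _
          exact hx x (le_antisymm h3 (h _).2.1)
      · rw [h2, hq, hkq, max_self]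
    · intro hT h hc hx y hy
      obtain ⟨q, rfl⟩ := tau_surj T y
      have hq : q ∈ T.theta := hT ⟨fun q => h (T.tau q), hc.comp (tau_cont T), fun x => by
        simp only [tau_unit]; exact hx _, hy⟩
      have : T.tau q = stoneCechUnit T.pt := hq
      rw [this] at hy
      exact hx _ hy

variable {P : (Z : Type u) → [TopologicalSpace Z] → Prop}

theorem P_image (hProp : TopProperty P) {Z W : Type u} [TopologicalSpace Z] [TopologicalSpace W]
    {f : Z → W} (hf : IsEmbedding f) (A : Set Z) : P ↥(f '' A) ↔ P ↥A :=
  ⟨hProp _ _ (hf.homeomorphImage A).symm, hProp _ _ (hf.homeomorphImage A)⟩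

theorem P_sub (hProp : TopProperty P) (hch : ClosedHereditary P) {Z : Type u}
    [TopologicalSpace Z] {A B : Set Z} (hB : P ↥B) (hA : IsClosed A) (hAB : A ⊆ B) : P ↥A := by
  have h1 := hch ↥B hB (Subtype.val ⁻¹' A) (hA.preimage continuous_subtype_val)
  rw [← P_image hProp IsEmbedding.subtypeVal, Subtype.image_preimage_coe,
    inter_eq_right.2 hAB] at h1
  exact h1

theorem P_union (hProp : TopProperty P) (hfs : FiniteClosedSums P) {Z : Type u}
    [TopologicalSpace Z] [T2Space Z] {A B : Set Z} (hA : P ↥A) (hB : P ↥B) (hAc : IsClosed A)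
    (hBc : IsClosed B) : P ↥(A ∪ B) := by
  have key : ∀ C : Set Z, C ⊆ A ∪ B → P ↥C → P ↥(Subtype.val ⁻¹' C : Set ↥(A ∪ B)) := by
    intro C hC h
    rw [← P_image hProp IsEmbedding.subtypeVal, Subtype.image_preimage_coe, inter_eq_right.2 hC]
    exact h
  refine hfs ↥(A ∪ B) 2 ![Subtype.val ⁻¹' A, Subtype.val ⁻¹' B] ?_ ?_ ?_
  · rw [Fin.forall_fin_two]
    exact ⟨hAc.preimage continuous_subtype_val, hBc.preimage continuous_subtype_val⟩
  · rw [Fin.forall_fin_two]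
    exact ⟨key A subset_union_left hA, key B subset_union_right hB⟩
  · ext ⟨z, hz⟩
    simpa [Fin.exists_fin_two] using hz

theorem P_empty (hfs : FiniteClosedSums P) {Z : Type u} [TopologicalSpace Z] [IsEmpty Z] :
    P Z := by
  have : T2Space Z := ⟨fun x => isEmptyElim x⟩
  exact hfs Z 0 Fin.elim0 (fun i => i.elim0) (fun i => i.elim0) (Subsingleton.elim _ _)

theorem mrowka_core [T35Space X] (hProp : TopProperty P) (hch : ClosedHereditary P)
    (hW : MrowkaW P) (hfs : FiniteClosedSums P) (hloc : LocallyP P X) (hn : ¬ P X) :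
    ∃ C0 : Set (StoneCech X), C0.Nonempty ∧ (∀ x, stoneCechUnit x ∉ C0) ∧
      ∀ T : OnePointExt X, P T.carrier ↔ C0 ⊆ T.theta := by
  let sm : Set (StoneCech X) → Prop := fun s => P ↥(closure (stoneCechUnit ⁻¹' s : Set X))
  have sm_mono : ∀ s t, s ⊆ t → sm t → sm s := fun s t hst ht =>
    P_sub hProp hch ht isClosed_closure (closure_mono (preimage_mono hst))
  have sm_cpt : ∀ K : Set (StoneCech X), IsCompact K → (∀ q ∈ K, ∃ N ∈ 𝓝 q, sm N) → sm K := by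
    intro K hK hq
    refine hK.induction_on (p := sm) ?_ sm_mono ?_ ?_
    · change P ↥(closure (stoneCechUnit ⁻¹' ∅ : Set X))
      have : IsEmpty ↥(closure (stoneCechUnit ⁻¹' ∅ : Set X)) := by simp
      exact P_empty hfs
    · intro s t hs ht
      change P ↥(closure (stoneCechUnit ⁻¹' (s ∪ t) : Set X))
      rw [preimage_union, closure_union]
      exact P_union hProp hfs hs ht isClosed_closure isClosed_closure
    · intro q hqK
      obtain ⟨N, hN, hs⟩ := hq q hqK
      exact ⟨N, mem_nhdsWithin_of_mem_nhds hN, hs⟩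
  refine ⟨{q | ∀ N ∈ 𝓝 q, ¬ sm N}, ?_, ?_, ?_⟩
  · by_contra hne
    rw [not_nonempty_iff_eq_empty, eq_empty_iff_forall_notMem] at hne
    have h1 : sm univ := sm_cpt univ isCompact_univ fun q _ => by
      have := hne q
      simp only [mem_ofPred_eq] at this
      push Not at this
      exact this
    have h2 : P ↥(univ : Set X) := P_sub hProp hch h1 isClosed_univ (by simp)
    exact hn (hProp _ _ (Homeomorph.Set.univ X) h2)
  · intro x hx
    obtain ⟨U, hU, hxU, hPU⟩ := hloc x
    obtain ⟨N, hN, rfl⟩ := isInducing_stoneCechUnit.isOpen_iff.1 hU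
    exact hx N (hN.mem_nhds hxU) hPU
  · intro T
    constructor
    · intro hT q hq
      by_contra hqT
      obtain ⟨N, hN, hNc, hNT⟩ := exists_mem_nhds_isClosed_subset
        ((theta_closed T).isOpen_compl.mem_nhds hqT)
      apply hq N hN
      have hcl : IsClosed (stoneCechUnit ⁻¹' N : Set X) := hNc.preimage continuous_stoneCechUnit
      have h1 : IsClosed (T.ι '' (stoneCechUnit ⁻¹' N)) := by
        rw [← isOpen_compl_iff, isOpen_iff_mem_nhds]
        intro t ht
        rcases cases_pt T t with rfl | ⟨x, rfl⟩
        · have h2 : (stoneCechUnit ⁻¹' Nᶜ : Set X) ∈ comap T.ι (𝓝 T.pt) := by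
            rw [comap_iota]
            exact preimage_mem_comap
              (hNc.isOpen_compl.mem_nhdsSet.2 (subset_compl_comm.1 hNT))
          obtain ⟨v, hv, hvs⟩ := mem_comap.1 h2
          filter_upwards [hv] with t ht
          rintro ⟨x, hx, rfl⟩
          exact hvs ht hx
        · have hx : x ∉ (stoneCechUnit ⁻¹' N : Set X) := fun h => ht ⟨x, h, rfl⟩
          have h2 := (iota_open T).image_mem_nhds.2 (hcl.isOpen_compl.mem_nhds hx)
          filter_upwards [h2]
          rintro _ ⟨y, hy, rfl⟩ ⟨z, hz, hzy⟩
          rw [T.emb.injective hzy] at hz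
          exact hy hz
      have h3 := hch _ hT _ h1
      rw [P_image hProp T.emb] at h3
      change P ↥(closure (stoneCechUnit ⁻¹' N : Set X))
      rw [hcl.closure_eq]
      exact h3
    · intro hT
      refine hW T.carrier T.pt {b | IsOpen b ∧ T.pt ∈ b} (fun b hb => hb)
        (fun V hV hp => ⟨V, ⟨hV, hp⟩, Subset.rfl⟩) ?_
      rintro b ⟨hb, hp⟩
      have h1 : T.ι ⁻¹' b ∈ comap stoneCechUnit (𝓝ˢ T.theta) := by
        rw [← comap_iota]
        exact preimage_mem_comap (hb.mem_nhds hp)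
      obtain ⟨O', hO', hOb⟩ := mem_comap.1 h1
      obtain ⟨O, hO, hTO, hOO⟩ := mem_nhdsSet_iff_exists.1 hO'
      have h2 : sm Oᶜ := sm_cpt _ hO.isClosed_compl.isCompact fun q hq => by
        by_contra hne
        push Not at hne
        exact hq (hTO (hT hne))
      have h3 : bᶜ = T.ι '' (T.ι ⁻¹' bᶜ) := by
        rw [image_preimage_eq_inter_range, T.range_eq, eq_comm, inter_eq_left]
        intro t ht hte
        rw [mem_singleton_iff.1 hte] at ht
        exact ht hp
      rw [h3, P_image hProp T.emb]
      refine P_sub hProp hch h2 (hb.isClosed_compl.preimage T.emb.continuous) ?_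
      refine Subset.trans ?_ subset_closure
      intro x hx hxO
      exact hx (hOb (hOO hxO))

theorem core [T35Space X] (hProp : TopProperty P)
    (hP : IsPseudocompactness P ∨ (ClosedHereditary P ∧ MrowkaW P ∧ FiniteClosedSums P))
    (hloc : LocallyP P X) (hn : ¬ P X) :
    ∃ C0 : Set (StoneCech X), C0.Nonempty ∧ (∀ x, stoneCechUnit x ∉ C0) ∧
      ∀ T : OnePointExt X, P T.carrier ↔ C0 ⊆ T.theta := by
  rcases hP with hP | ⟨hch, hW, hfs⟩
  · obtain ⟨C0, h1, h2, h3⟩ := pseudo_core (X := X) (fun h => hn ((hP X).2 h))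
    exact ⟨C0, h1, h2, fun T => (hP _).trans (h3 T)⟩
  · exact mrowka_core hProp hch hW hfs hloc hn

end PropertyP

/-- The representation of one-point extensions by closed subsets of a compact space. -/
structure Rep (P : (Z : Type u) → [TopologicalSpace Z] → Prop) (X : Type u) [TopologicalSpace X]
    (K : Type u) [TopologicalSpace K] (s : OnePointExt X → Set K) (C0 : Set K) : Prop where
  ne : C0.Nonempty
  cl : ∀ T, IsClosed (s T)
  surj : ∀ C : Set K, IsClosed C → C.Nonempty → ∃ T, s T = C
  le : ∀ T1 T2, OnePointExt.le T1 T2 ↔ s T2 ⊆ s T1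
  eqv : ∀ T1 T2, OnePointExt.equiv T1 T2 ↔ s T1 = s T2
  lc : ∀ T, LocallyCompactSpace T.carrier ↔ IsOpen (s T)
  cech : ∀ T, CechComplete T.carrier ↔ IsGδ (s T)
  prop : ∀ T, P T.carrier ↔ C0 ⊆ s T

theorem exists_rep [T35Space X] [LocallyCompactSpace X]
    (P : (Z : Type u) → [TopologicalSpace Z] → Prop) (hProp : TopProperty P)
    (hP : IsPseudocompactness P ∨ (ClosedHereditary P ∧ MrowkaW P ∧ FiniteClosedSums P))
    (hloc : LocallyP P X) (hn : ¬ P X) : ∃ C0 : Set (Rem X), Rep P X (Rem X) S C0 := by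
  obtain ⟨C0, h1, h2, h3⟩ := core hProp hP hloc hn
  refine ⟨Subtype.val ⁻¹' C0, ?_, ?_, ?_, ?_, ?_, ?_, ?_, ?_⟩
  · obtain ⟨q, hq⟩ := h1
    exact ⟨⟨q, by rintro ⟨x, rfl⟩; exact h2 x hq⟩, hq⟩
  · exact fun T => (theta_closed T).preimage continuous_subtype_val
  · intro C hC hne
    obtain ⟨T, hT⟩ := realize (Subtype.val '' C) (rem_closed.isClosedMap _ hC) (hne.image _) (by
      rintro x ⟨q, -, hq⟩
      exact q.2 ⟨x, hq.symm⟩)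
    refine ⟨T, ?_⟩
    rw [S, hT, preimage_image_eq _ Subtype.val_injective]
  · intro T1 T2
    rw [le_iff, S_subset]
  · intro T1 T2
    constructor
    · intro h
      rw [S, S, eq_of_equiv T1 T2 h]
    · intro h
      apply equiv_of_eq
      rw [← image_S T1, ← image_S T2, h]
  · intro T
    rw [lc_iff, S_open]
  · intro T
    rw [cech_iff, S_gdelta]
  · intro T
    rw [h3]
    constructor
    · exact fun h => preimage_mono h
    · intro h q hq
      exact h (show (⟨q, by rintro ⟨x, rfl⟩; exact h2 x hq⟩ : Rem X) ∈ Subtype.val ⁻¹' C0 from hq)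

section Abstract

theorem cpt_sub {K : Type*} [TopologicalSpace K] [CompactSpace K] {F : ℕ → Set K}
    (hF : Antitone F) (hc : ∀ n, IsClosed (F n)) {U : Set K} (hU : IsOpen U)
    (h : ⋂ n, F n ⊆ U) : ∃ n, F n ⊆ U :=
  exists_subset_nhds_of_isCompact' hF.directed_ge (fun n => (hc n).isCompact) hc
    (fun x hx => hU.mem_nhds (h hx))

variable {P : (Z : Type u) → [TopologicalSpace Z] → Prop}
variable {Y : Type u} [TopologicalSpace Y]
variable {K L : Type u} [TopologicalSpace K] [TopologicalSpace L]
variable [CompactSpace K] [CompactSpace L] [T2Space K] [T2Space L]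
variable {s : OnePointExt X → Set K} {t : OnePointExt Y → Set L} {C : Set K} {D : Set L}

theorem cech_of_lc (hX : Rep P X K s C) (T : OnePointExt X) (h : LocallyCompactSpace T.carrier) :
    CechComplete T.carrier := by
  rw [hX.cech]
  exact ((hX.lc T).1 h).isGδ

theorem surj' (hX : Rep P X K s C) (A : Set K) (hA : IsClosed A) (hCA : C ⊆ A) :
    ∃ T, s T = A ∧ P T.carrier := by
  obtain ⟨T, rfl⟩ := hX.surj A hA (hX.ne.mono hCA)
  exact ⟨T, rfl, (hX.prop T).2 hCA⟩

/-- An order isomorphism maps locally compact extensions to locally compact extensions. -/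
theorem fwd_lc (hX : Rep P X K s C) (hY : Rep P Y L t D) (Δ : OnePointExt X → OnePointExt Y)
    (hΔ : RestrictedOrderIso {T : OnePointExt X | P T.carrier ∧ CechComplete T.carrier}
        {S : OnePointExt Y | P S.carrier ∧ CechComplete S.carrier} Δ)
    (T : OnePointExt X) (hT : P T.carrier) (hlc : LocallyCompactSpace T.carrier) :
    LocallyCompactSpace (Δ T).carrier := by
  obtain ⟨h1, h2, h3⟩ := hΔ
  have hTA : T ∈ {T : OnePointExt X | P T.carrier ∧ CechComplete T.carrier} :=
    ⟨hT, cech_of_lc hX T hlc⟩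
  obtain ⟨hΔP, hΔC⟩ := h1 T hTA
  obtain ⟨f, hf, -, -, hf01⟩ := exists_continuous_one_zero_of_isCompact_of_isGδ
    (hY.cl (Δ T)).isCompact ((hY.cech _).1 hΔC) isClosed_empty (disjoint_empty _)
  have hmem : ∀ y, y ∈ t (Δ T) ↔ f y = 1 := fun y => by rw [hf]; rfl
  let G : ℕ → Set L := fun n => {y | 1 - 1 / ((n : ℝ) + 1) ≤ f y}
  have hpos : ∀ n : ℕ, (0 : ℝ) < 1 / ((n : ℝ) + 1) := fun n => Nat.one_div_pos_of_nat
  have hGc : ∀ n, IsClosed (G n) := fun n => isClosed_le continuous_const f.continuous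
  have hGd : ∀ n, IsGδ (G n) := by
    intro n
    have : G n = f ⁻¹' (Ici (1 - 1 / ((n : ℝ) + 1))) := rfl
    rw [this]
    exact (isClosed_Ici.isGδ).preimage f.continuous
  have hGT : ∀ n, t (Δ T) ⊆ G n := by
    intro n y hy
    have h4 := hpos n
    have h5 := (hmem y).1 hy
    change 1 - 1 / ((n : ℝ) + 1) ≤ f y
    linarith
  have hGi : ⋂ n, G n ⊆ t (Δ T) := by
    intro y hy
    rw [hmem]
    refine le_antisymm (hf01 y).2 ?_
    by_contra hlt
    obtain ⟨n, hn⟩ := exists_nat_one_div_lt (sub_pos.2 (not_le.1 hlt))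
    have : 1 - 1 / ((n : ℝ) + 1) ≤ f y := mem_iInter.1 hy n
    linarith
  have hGanti : Antitone G := by
    intro m n hmn y hy
    have h4 : 1 - 1 / ((n : ℝ) + 1) ≤ f y := hy
    change 1 - 1 / ((m : ℝ) + 1) ≤ f y
    have h5 : 1 / ((n : ℝ) + 1) ≤ 1 / ((m : ℝ) + 1) := Nat.one_div_le_one_div hmn
    linarith
  have hex : ∀ n, ∃ R : OnePointExt X, (P R.carrier ∧ CechComplete R.carrier) ∧ t (Δ R) = G n := by
    intro n
    obtain ⟨R, hR, hRP⟩ := surj' hY (G n) (hGc n) (((hY.prop _).1 hΔP).trans (hGT n))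
    obtain ⟨Q, hQ, hQR⟩ := h3 R ⟨hRP, (hY.cech R).2 (by rw [hR]; exact hGd n)⟩
    exact ⟨Q, hQ, by rw [(hY.eqv _ _).1 hQR, hR]⟩
  choose R hR hRG using hex
  have hord : ∀ T1 T2 : OnePointExt X, P T1.carrier ∧ CechComplete T1.carrier →
      P T2.carrier ∧ CechComplete T2.carrier → (s T2 ⊆ s T1 ↔ t (Δ T2) ⊆ t (Δ T1)) := by
    intro T1 T2 hT1 hT2
    rw [← hX.le, ← hY.le]
    exact h2 T1 hT1 T2 hT2
  have hRanti : Antitone fun n => s (R n) := by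
    intro m n hmn
    change s (R n) ⊆ s (R m)
    rw [hord _ _ (hR m) (hR n), hRG, hRG]
    exact hGanti hmn
  obtain ⟨Q, hQ, hQP⟩ := surj' hX (⋂ n, s (R n)) (isClosed_iInter fun n => hX.cl _)
    (subset_iInter fun n => (hX.prop _).1 (hR n).1)
  have hQC : P Q.carrier ∧ CechComplete Q.carrier :=
    ⟨hQP, (hX.cech Q).2 (by rw [hQ]; exact IsGδ.iInter fun n => (hX.cech _).1 (hR n).2)⟩
  have hQT : s Q ⊆ s T := by
    rw [hord _ _ hTA hQC]
    refine Subset.trans (subset_iInter fun n => ?_) hGi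
    rw [← hRG n, ← hord _ _ (hR n) hQC, hQ]
    exact iInter_subset _ n
  obtain ⟨n, hn⟩ := cpt_sub hRanti (fun n => hX.cl _) ((hX.lc T).1 hlc) (by rw [← hQ]; exact hQT)
  have h4 : G n ⊆ t (Δ T) := by
    rw [← hRG n, ← hord _ _ hTA (hR n)]
    exact hn
  rw [hY.lc]
  have h5 : t (Δ T) = {y | 1 - 1 / ((n : ℝ) + 1) < f y} := by
    refine Subset.antisymm ?_ (fun y hy => h4 (le_of_lt (show 1 - 1 / ((n : ℝ) + 1) < f y from hy)))
    intro y hy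
    have h6 := (hmem y).1 hy
    have h7 := hpos n
    change 1 - 1 / ((n : ℝ) + 1) < f y
    linarith
  rw [h5]
  exact isOpen_lt continuous_const f.continuous

theorem exists_inverse (hX : Rep P X K s C) (hY : Rep P Y L t D)
    {A : Set (OnePointExt X)} {B : Set (OnePointExt Y)} [Nonempty (OnePointExt X)]
    {Δ : OnePointExt X → OnePointExt Y} (h : RestrictedOrderIso A B Δ) :
    ∃ E : OnePointExt Y → OnePointExt X, RestrictedOrderIso B A E ∧
      ∀ T ∈ A, s (E (Δ T)) = s T := by
  classical
  obtain ⟨h1, h2, h3⟩ := h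
  have hex : ∀ R : OnePointExt Y, ∃ T : OnePointExt X, R ∈ B → T ∈ A ∧ t (Δ T) = t R := by
    intro R
    by_cases hR : R ∈ B
    · obtain ⟨T, hT, hTR⟩ := h3 R hR
      exact ⟨T, fun _ => ⟨hT, (hY.eqv _ _).1 hTR⟩⟩
    · exact ⟨Classical.arbitrary _, fun h => absurd h hR⟩
  choose E hE using hex
  have hord : ∀ T1 ∈ A, ∀ T2 ∈ A, (s T2 ⊆ s T1 ↔ t (Δ T2) ⊆ t (Δ T1)) := by
    intro T1 hT1 T2 hT2
    rw [← hX.le, ← hY.le]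
    exact h2 T1 hT1 T2 hT2
  have hEΔ : ∀ T ∈ A, s (E (Δ T)) = s T := by
    intro T hT
    obtain ⟨h4, h5⟩ := hE _ (h1 T hT)
    exact Subset.antisymm ((hord _ hT _ h4).2 h5.le) ((hord _ h4 _ hT).2 h5.ge)
  refine ⟨E, ⟨fun R hR => (hE R hR).1, ?_, ?_⟩, hEΔ⟩
  · intro R1 hR1 R2 hR2
    rw [hX.le, hY.le, hord _ (hE R1 hR1).1 _ (hE R2 hR2).1, (hE R1 hR1).2, (hE R2 hR2).2]
  · intro T hT
    exact ⟨Δ T, h1 T hT, (hX.eqv _ _).2 (hEΔ T hT)⟩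

theorem forward (hX : Rep P X K s C) (hY : Rep P Y L t D) (Δ : OnePointExt X → OnePointExt Y)
    (hΔ : RestrictedOrderIso {T : OnePointExt X | P T.carrier ∧ CechComplete T.carrier}
        {S : OnePointExt Y | P S.carrier ∧ CechComplete S.carrier} Δ) :
    RestrictedOrderIso {T : OnePointExt X | P T.carrier ∧ LocallyCompactSpace T.carrier}
        {S : OnePointExt Y | P S.carrier ∧ LocallyCompactSpace S.carrier} Δ := by
  have : Nonempty (OnePointExt X) := by
    obtain ⟨T, -⟩ := hX.surj univ isClosed_univ (hX.ne.mono (subset_univ _))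
    exact ⟨T⟩
  obtain ⟨E, hE, hEΔ⟩ := exists_inverse hX hY hΔ
  have hfwd := fwd_lc hX hY Δ hΔ
  have hbwd := fwd_lc hY hX E hE
  obtain ⟨h1, h2, h3⟩ := hΔ
  refine ⟨?_, ?_, ?_⟩
  · rintro T ⟨hT, hlc⟩
    exact ⟨(h1 T ⟨hT, cech_of_lc hX T hlc⟩).1, hfwd T hT hlc⟩
  · rintro T1 ⟨hT1, hlc1⟩ T2 ⟨hT2, hlc2⟩
    exact h2 T1 ⟨hT1, cech_of_lc hX T1 hlc1⟩ T2 ⟨hT2, cech_of_lc hX T2 hlc2⟩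
  · rintro R ⟨hR, hlc⟩
    obtain ⟨T, hT, hTR⟩ := h3 R ⟨hR, cech_of_lc hY R hlc⟩
    refine ⟨T, ⟨hT.1, ?_⟩, hTR⟩
    have h4 : LocallyCompactSpace (Δ T).carrier := by
      rw [hY.lc, (hY.eqv _ _).1 hTR, ← hY.lc]
      exact hlc
    have h5 := hbwd (Δ T) (h1 T hT).1 h4
    rw [hX.lc, hEΔ T hT, ← hX.lc] at h5
    exact h5

/-- Zero-dimensionality: clopen base. -/
def ClopenBase (K : Type u) [TopologicalSpace K] : Prop :=
  ∀ U : Set K, IsOpen U → ∀ x ∈ U, ∃ V : Set K, IsClopen V ∧ x ∈ V ∧ V ⊆ U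

theorem clopen_between (hK : ClopenBase K) {A U : Set K} (hA : IsClosed A) (hU : IsOpen U)
    (hAU : A ⊆ U) : ∃ V, IsClopen V ∧ A ⊆ V ∧ V ⊆ U := by
  refine hA.isCompact.induction_on (p := fun B => ∃ V, IsClopen V ∧ B ⊆ V ∧ V ⊆ U) ?_ ?_ ?_ ?_
  · exact ⟨∅, isClopen_empty, Subset.rfl, empty_subset _⟩
  · rintro B B' hB ⟨V, h1, h2, h3⟩
    exact ⟨V, h1, hB.trans h2, h3⟩
  · rintro B B' ⟨V, h1, h2, h3⟩ ⟨V', h1', h2', h3'⟩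
    exact ⟨V ∪ V', h1.union h1', union_subset_union h2 h2', union_subset h3 h3'⟩
  · intro x hx
    obtain ⟨V, h1, h2, h3⟩ := hK U hU x (hAU hx)
    exact ⟨V, mem_nhdsWithin_of_mem_nhds (h1.isOpen.mem_nhds h2), V, h1, Subset.rfl, h3⟩

theorem exists_seq (hX : Rep P X K s C) (hK : ClopenBase K) (T : OnePointExt X)
    (hT : P T.carrier) (hc : CechComplete T.carrier) :
    ∃ V : ℕ → OnePointExt X, (∀ n, P (V n).carrier ∧ LocallyCompactSpace (V n).carrier) ∧
      Antitone (fun n => s (V n)) ∧ ⋂ n, s (V n) = s T := by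
  obtain ⟨O, hO, hOe⟩ := ((hX.cech T).1 hc).eq_iInter_nat
  have h1 : ∀ n, ∃ W, IsClopen W ∧ s T ⊆ W ∧ W ⊆ O n := fun n =>
    clopen_between hK (hX.cl T) (hO n) (hOe ▸ iInter_subset _ n)
  choose W hW hTW hWO using h1
  have hG : ∀ n : ℕ, IsClopen (⋂ k ∈ Finset.range (n + 1), W k) := fun n =>
    isClopen_biInter_finset fun k _ => hW k
  have hTG : ∀ n : ℕ, s T ⊆ ⋂ k ∈ Finset.range (n + 1), W k := fun n =>
    subset_iInter₂ fun k _ => hTW k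
  have h2 : ∀ n, ∃ V : OnePointExt X, s V = (⋂ k ∈ Finset.range (n + 1), W k) ∧ P V.carrier :=
    fun n => surj' hX _ (hG n).isClosed (((hX.prop T).1 hT).trans (hTG n))
  choose V hV hVP using h2
  refine ⟨V, fun n => ⟨hVP n, (hX.lc _).2 (by rw [hV]; exact (hG n).isOpen)⟩, ?_, ?_⟩
  · intro m n hmn
    change s (V n) ⊆ s (V m)
    rw [hV, hV]
    refine biInter_subset_biInter_left ?_
    intro k hk
    simp only [Finset.coe_range, mem_Iio, Finset.mem_range] at hk ⊢
    have : k < m + 1 := by simpa using hk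
    have : k < n + 1 := by omega
    simpa using this
  · refine Subset.antisymm ?_ (subset_iInter fun n => by rw [hV]; exact hTG n)
    rw [hOe]
    refine subset_iInter fun n => (iInter_subset _ n).trans ?_
    rw [hV]
    exact (biInter_subset_of_mem (by simp)).trans (hWO n)

theorem backward (hX : Rep P X K s C) (hY : Rep P Y L t D) (hK : ClopenBase K)
    (hL : ClopenBase L) (δ : OnePointExt X → OnePointExt Y)
    (hδ : RestrictedOrderIso {T : OnePointExt X | P T.carrier ∧ LocallyCompactSpace T.carrier}
        {S : OnePointExt Y | P S.carrier ∧ LocallyCompactSpace S.carrier} δ) :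
    ∃ Δ : OnePointExt X → OnePointExt Y,
      RestrictedOrderIso {T : OnePointExt X | P T.carrier ∧ CechComplete T.carrier}
        {S : OnePointExt Y | P S.carrier ∧ CechComplete S.carrier} Δ ∧
      ∀ T : OnePointExt X, P T.carrier → LocallyCompactSpace T.carrier →
        (Δ T).equiv (δ T) := by
  obtain ⟨h1, h2, h3⟩ := hδ
  have hord : ∀ T1 T2 : OnePointExt X, P T1.carrier ∧ LocallyCompactSpace T1.carrier →
      P T2.carrier ∧ LocallyCompactSpace T2.carrier →
      (s T2 ⊆ s T1 ↔ t (δ T2) ⊆ t (δ T1)) := by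
    intro T1 T2 hT1 hT2
    rw [← hX.le, ← hY.le]
    exact h2 T1 hT1 T2 hT2
  have hG : ∀ T : OnePointExt X, ∃ R : OnePointExt Y,
      (∀ y, y ∈ t R ↔ ∀ V : OnePointExt X, P V.carrier ∧ LocallyCompactSpace V.carrier →
        s T ⊆ s V → y ∈ t (δ V)) ∧ P R.carrier := by
    intro T
    obtain ⟨R, hR, hRP⟩ := surj' hY (⋂ V : OnePointExt X,
      ⋂ _ : P V.carrier ∧ LocallyCompactSpace V.carrier, ⋂ _ : s T ⊆ s V, t (δ V))
      (isClosed_iInter fun V => isClosed_iInter fun _ => isClosed_iInter fun _ => hY.cl _)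
      (subset_iInter fun V => subset_iInter fun hV => subset_iInter fun _ =>
        (hY.prop _).1 (h1 V hV).1)
    exact ⟨R, fun y => by rw [hR]; simp only [mem_iInter], hRP⟩
  choose Δ hΔ hΔP using hG
  -- description by a sequence
  have hseq : ∀ (T : OnePointExt X) (V : ℕ → OnePointExt X),
      (∀ n, P (V n).carrier ∧ LocallyCompactSpace (V n).carrier) →
      Antitone (fun n => s (V n)) → ⋂ n, s (V n) = s T → t (Δ T) = ⋂ n, t (δ (V n)) := by
    intro T V hV hVa hVT
    refine Subset.antisymm (subset_iInter fun n y hy => ?_) fun y hy => ?_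
    · exact (hΔ T y).1 hy (V n) (hV n) (hVT ▸ iInter_subset _ n)
    · rw [hΔ]
      intro W hW hTW
      obtain ⟨n, hn⟩ := cpt_sub hVa (fun n => hX.cl _) ((hX.lc W).1 hW.2) (by rw [hVT]; exact hTW)
      exact (hord _ _ hW (hV n)).1 hn (mem_iInter.1 hy n)
  have hδanti : ∀ V : ℕ → OnePointExt X,
      (∀ n, P (V n).carrier ∧ LocallyCompactSpace (V n).carrier) →
      Antitone (fun n => s (V n)) → Antitone (fun n => t (δ (V n))) :=
    fun V hV hVa m n hmn => (hord _ _ (hV m) (hV n)).1 (hVa hmn)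
  refine ⟨Δ, ⟨?_, ?_, ?_⟩, ?_⟩
  · rintro T ⟨hT, hc⟩
    refine ⟨hΔP T, ?_⟩
    obtain ⟨V, hV, hVa, hVT⟩ := exists_seq hX hK T hT hc
    rw [hY.cech, hseq T V hV hVa hVT]
    exact IsGδ.iInter fun n => ((hY.lc _).1 (h1 _ (hV n)).2).isGδ
  · rintro T1 ⟨hT1, hc1⟩ T2 ⟨hT2, hc2⟩
    rw [hX.le, hY.le]
    constructor
    · intro h y hy
      rw [hΔ] at hy ⊢
      exact fun V hV hTV => hy V hV (h.trans hTV)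
    · intro h
      obtain ⟨V, hV, hVa, hVT⟩ := exists_seq hX hK T1 hT1 hc1
      obtain ⟨W, hW, hWa, hWT⟩ := exists_seq hX hK T2 hT2 hc2
      rw [hseq T1 V hV hVa hVT, hseq T2 W hW hWa hWT] at h
      rw [← hVT]
      refine subset_iInter fun n => ?_
      obtain ⟨m, hm⟩ := cpt_sub (hδanti W hW hWa) (fun n => hY.cl _)
        ((hY.lc _).1 (h1 _ (hV n)).2) (h.trans (iInter_subset _ n))
      refine Subset.trans ?_ ((hord _ _ (hV n) (hW m)).2 hm)
      rw [← hWT]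
      exact iInter_subset _ m
  · rintro R ⟨hR, hc⟩
    obtain ⟨W, hW, hWa, hWR⟩ := exists_seq hY hL R hR hc
    have hex : ∀ n, ∃ V : OnePointExt X, (P V.carrier ∧ LocallyCompactSpace V.carrier) ∧
        t (δ V) = t (W n) := by
      intro n
      obtain ⟨V, hV, hVW⟩ := h3 (W n) (hW n)
      exact ⟨V, hV, (hY.eqv _ _).1 hVW⟩
    choose V hV hVW using hex
    have hVa : Antitone fun n => s (V n) := by
      intro m n hmn
      change s (V n) ⊆ s (V m)
      rw [hord _ _ (hV m) (hV n), hVW, hVW]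
      exact hWa hmn
    obtain ⟨T, hT, hTP⟩ := surj' hX (⋂ n, s (V n)) (isClosed_iInter fun n => hX.cl _)
      (subset_iInter fun n => (hX.prop _).1 (hV n).1)
    refine ⟨T, ⟨hTP, ?_⟩, ?_⟩
    · rw [hX.cech, hT]
      exact IsGδ.iInter fun n => ((hX.lc _).1 (hV n).2).isGδ
    · rw [hY.eqv, hseq T V hV hVa hT.symm, ← hWR]
      exact iInter_congr hVW
  · intro T hT hlc
    rw [hY.eqv]
    refine Subset.antisymm (fun y hy => (hΔ T y).1 hy T ⟨hT, hlc⟩ Subset.rfl) fun y hy => ?_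
    rw [hΔ]
    exact fun V hV hTV => (hord _ _ hV ⟨hT, hlc⟩).1 hTV hy

end Abstract

theorem clopenBase_rem (h : StronglyZeroDimensional X) : ClopenBase (Rem X) := by
  rintro U hU x hx
  obtain ⟨O, hO, rfl⟩ := isOpen_induced_iff.1 hU
  obtain ⟨V, hV, hxV, hVO⟩ := h O hO x hx
  exact ⟨Subtype.val ⁻¹' V, hV.preimage continuous_subtype_val, hxV, preimage_mono hVO⟩

theorem compact_rem [T35Space X] [LocallyCompactSpace X] : CompactSpace (Rem X) :=
  isCompact_iff_compactSpace.1 isOpen_range_unit.isClosed_compl.isCompact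

end Stmt16

/-- Let `X` and `Y` be locally compact, locally-P Tychonoff spaces not
having `P`, where `P` is either pseudocompactness or a closed hereditary Mrówka topological
property preserved under finite closed sums of subspaces.  Every order-isomorphism from
`(E^C_P(X), ≤)` onto `(E^C_P(Y), ≤)` restricts to an order-isomorphism from `(E^K_P(X), ≤)`
onto `(E^K_P(Y), ≤)`.  Conversely, if `X` and `Y` are moreover strongly zero-dimensional,
every order-isomorphism from `(E^K_P(X), ≤)` onto `(E^K_P(Y), ≤)` extends to an
order-isomorphism from `(E^C_P(X), ≤)` onto `(E^C_P(Y), ≤)`. -/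
theorem stmt16 {X Y : Type u} [TopologicalSpace X] [T35Space X] [LocallyCompactSpace X]
    [TopologicalSpace Y] [T35Space Y] [LocallyCompactSpace Y]
    (P : (Z : Type u) → [TopologicalSpace Z] → Prop) (hProp : TopProperty P)
    (hP : IsPseudocompactness P ∨ (ClosedHereditary P ∧ MrowkaW P ∧ FiniteClosedSums P))
    (hlocX : LocallyP P X) (hlocY : LocallyP P Y) (hnX : ¬ P X) (hnY : ¬ P Y) :
    (∀ Δ : OnePointExt X → OnePointExt Y,
      RestrictedOrderIso {T : OnePointExt X | P T.carrier ∧ CechComplete T.carrier}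
        {S : OnePointExt Y | P S.carrier ∧ CechComplete S.carrier} Δ →
      RestrictedOrderIso {T : OnePointExt X | P T.carrier ∧ LocallyCompactSpace T.carrier}
        {S : OnePointExt Y | P S.carrier ∧ LocallyCompactSpace S.carrier} Δ) ∧
    (StronglyZeroDimensional X → StronglyZeroDimensional Y →
      ∀ δ : OnePointExt X → OnePointExt Y,
        RestrictedOrderIso {T : OnePointExt X | P T.carrier ∧ LocallyCompactSpace T.carrier}
          {S : OnePointExt Y | P S.carrier ∧ LocallyCompactSpace S.carrier} δ →
        ∃ Δ : OnePointExt X → OnePointExt Y,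
          RestrictedOrderIso {T : OnePointExt X | P T.carrier ∧ CechComplete T.carrier}
            {S : OnePointExt Y | P S.carrier ∧ CechComplete S.carrier} Δ ∧
          ∀ T : OnePointExt X, P T.carrier → LocallyCompactSpace T.carrier →
            (Δ T).equiv (δ T)) := by
  obtain ⟨C, hX⟩ := Stmt16.exists_rep (X := X) P hProp hP hlocX hnX
  obtain ⟨D, hY⟩ := Stmt16.exists_rep (X := Y) P hProp hP hlocY hnY
  have := Stmt16.compact_rem (X := X)
  have := Stmt16.compact_rem (X := Y)
  exact ⟨fun Δ hΔ => Stmt16.forward hX hY Δ hΔ, fun hzX hzY δ hδ =>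
    Stmt16.backward hX hY (Stmt16.clopenBase_rem hzX) (Stmt16.clopenBase_rem hzY) δ hδ⟩
end
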